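/- Let t be a rational number with t ≠ 2, let α ∈ ℂ be a root of f_t (so α ≠ 0 since f_t(0) = 1), and let g_t = X³ + uX² + (v−3)X + (w − 2u) ∈ ℚ[X]. Then g_t(α + 1/α) = 0. Moreover, if in addition t ≠ 1, then g_t is irreducible over ℚ. -/

import Mathlib

open Polynomial

/-- `u` coefficient of the polynomial `f t`. -/
noncomputable def u (t : ℚ) : ℚ := (3*t^2 - 2*t + 2) / (t^2 + t - 1)

/-- `v` coefficient of the polynomial `f t`. -/
noncomputable def v (t : ℚ) : ℚ :=
  (t^5 - 5*t^4 + 10*t^3 - 20*t^2 + 15*t - 7) / ((t - 2) * (t^2 + t - 1)^2)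

/-- `w` coefficient of the polynomial `f t`. -/
noncomputable def w (t : ℚ) : ℚ :=
  (-3*t^5 + 10*t^4 - 20*t^3 + 20*t^2 - 20*t + 6) / ((t - 2) * (t^2 + t - 1)^2)

/-- The polynomial `f_t = X⁶ + uX⁵ + vX⁴ + wX³ + vX² + uX + 1 ∈ ℚ[X]`. -/
noncomputable def f (t : ℚ) : Polynomial ℚ :=
  X^6 + C (u t) * X^5 + C (v t) * X^4 + C (w t) * X^3 + C (v t) * X^2 + C (u t) * X + 1

/-- The cubic `g_t = X³ + uX² + (v−3)X + (w − 2u) ∈ ℚ[X]`, the minimal polynomial of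
`α + 1/α` for `α` a root of `f t`. -/
noncomputable def g (t : ℚ) : Polynomial ℚ :=
  X^3 + C (u t) * X^2 + C (v t - 3) * X + C (w t - 2 * u t)

namespace RC
open Module NumberField

theorem irr5 {c : ℚ} (hc : ∀ b : ℚ, b ^ 5 ≠ c) : Irreducible (X ^ 5 - C c : ℚ[X]) :=
  X_pow_sub_C_irreducible_of_prime (by norm_num) hc

theorem minpoly5 {K : Type*} [Field K] [NumberField K] {β : K} {c : ℚ}
    (hβ : β ^ 5 = algebraMap ℚ K c) (hc : ∀ b : ℚ, b ^ 5 ≠ c) :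
    minpoly ℚ β = X ^ 5 - C c := by
  symm
  apply minpoly.eq_of_irreducible_of_monic (irr5 hc)
  · simp [hβ]
  · exact monic_X_pow_sub_C _ (by norm_num)

theorem norm5 {K : Type*} [Field K] [NumberField K] (hK : finrank ℚ K = 5) {β : K} {c : ℚ}
    (hβ : β ^ 5 = algebraMap ℚ K c) (hc : ∀ b : ℚ, b ^ 5 ≠ c) (a : ℚ) :
    Algebra.norm ℚ (algebraMap ℚ K a - β) = a ^ 5 - c := by
  have h1 : (LinearMap.charpoly (Algebra.lmul ℚ K β)) = X ^ 5 - C c := by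
    symm
    rw [← minpoly5 hβ hc]
    symm
    apply Polynomial.eq_of_monic_of_dvd_of_natDegree_le
    · exact minpoly.monic (Algebra.IsIntegral.isIntegral β)
    · exact LinearMap.charpoly_monic _
    · apply minpoly.dvd
      have := LinearMap.aeval_self_charpoly (Algebra.lmul ℚ K β)
      have h2 := congrArg (fun l => l 1) this
      rw [Polynomial.aeval_algHom_apply] at h2
      simpa using h2
    · rw [LinearMap.charpoly_natDegree, hK, minpoly5 hβ hc, natDegree_X_pow_sub_C]
  have h2 := congrArg (Polynomial.eval a) h1
  let b := Module.finBasis ℚ K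
  rw [← LinearMap.charpoly_toMatrix _ b, Matrix.eval_charpoly] at h2
  simp only [eval_sub, eval_pow, eval_X, eval_C] at h2
  rw [← h2, Algebra.norm_eq_matrix_det b]
  congr 1
  rw [map_sub, AlgHom.commutes]
  rfl

theorem no5 {c : ℚ} (p : ℕ) [Fact p.Prime] (h : ¬ (5:ℤ) ∣ padicValRat p c) : ∀ b : ℚ, b ^ 5 ≠ c := by
  intro b hb
  apply h
  rw [← hb, padicValRat.pow (p := p) (q := b)]
  exact ⟨_, by push_cast; ring⟩

theorem no5_two : ∀ b : ℚ, b ^ 5 ≠ 2 := by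
  apply no5 2
  have : padicValRat 2 2 = 1 := by exact_mod_cast padicValRat.self (p := 2) (by norm_num)
  rw [this]; norm_num

theorem no5_pow (k : ℕ) (hk : ¬ 5 ∣ k): ∀ b : ℚ, b ^ 5 ≠ 2 ^ k := by
  apply no5 2
  have : padicValRat 2 2 = 1 := by exact_mod_cast padicValRat.self (p := 2) (by norm_num)
  rw [padicValRat.pow (p := 2) (q := 2), this, mul_one]; exact_mod_cast hk
section NF
variable {K : Type*} [Field K] [NumberField K]

/-- power basis generated by the fifth root of two -/
theorem exists_pb (hK : finrank ℚ K = 5) {θ : K} (hθ : θ ^ 5 = 2) :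
    ∃ pb : PowerBasis ℚ K, pb.gen = θ ∧ pb.dim = 5 := by
  have hm : minpoly ℚ θ = X ^ 5 - C 2 := minpoly5 (by simpa using hθ) no5_two
  have h1 : IntermediateField.adjoin ℚ {θ} = ⊤ := by
    rw [Field.primitive_element_iff_minpoly_natDegree_eq, hm, natDegree_X_pow_sub_C, hK]
  have h2 : Algebra.adjoin ℚ {θ} = ⊤ := by
    rw [← IntermediateField.adjoin_simple_toSubalgebra_of_isAlgebraic
      (Algebra.IsAlgebraic.isAlgebraic θ), h1]; rfl
  refine ⟨PowerBasis.ofAdjoinEqTop (Algebra.IsIntegral.isIntegral θ) h2, by simp, ?_⟩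
  rw [← PowerBasis.finrank, hK]

theorem hom_ext (hK : finrank ℚ K = 5) {θ : K} (hθ : θ ^ 5 = 2) {S : Type*} [Field S] [CharZero S]
    (f g : K →+* S) (h : f θ = g θ) : f = g := by
  obtain ⟨pb, h1, h2⟩ := exists_pb hK hθ
  have : (f.toRatAlgHom) = g.toRatAlgHom := pb.algHom_ext (by rw [h1]; exact h)
  ext x
  exact congrArg (fun l => l x) this

open scoped Classical in
theorem nrReal (hK : finrank ℚ K = 5) {θ : K} (hθ : θ ^ 5 = 2) :
    InfinitePlace.nrRealPlaces K = 1 ∧ InfinitePlace.nrComplexPlaces K = 2 := by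
  have h1 : InfinitePlace.nrRealPlaces K ≤ 1 := by
    rw [InfinitePlace.nrRealPlaces, Fintype.card_le_one_iff]
    rintro ⟨a, ha⟩ ⟨b, hb⟩
    rw [Subtype.mk.injEq]
    have h5 : (InfinitePlace.embedding_of_isReal ha θ) ^ 5 =
       (InfinitePlace.embedding_of_isReal hb θ) ^ 5 := by
      rw [← map_pow, ← map_pow, hθ, map_ofNat, map_ofNat]
    have h6 := (Odd.strictMono_pow (R := ℝ) (n := 5) (by decide)).injective h5
    have h7 := hom_ext hK hθ _ _ h6
    have h8 : a.embedding = b.embedding := by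
      ext x
      rw [← InfinitePlace.embedding_of_isReal_apply ha, ← InfinitePlace.embedding_of_isReal_apply hb, h7]
    rw [← InfinitePlace.mk_embedding a, ← InfinitePlace.mk_embedding b, h8]
  have h2 := InfinitePlace.card_add_two_mul_card_eq_rank K
  rw [hK] at h2
  omega

open scoped Classical in
theorem exists_real (hK : finrank ℚ K = 5) {θ : K} (hθ : θ ^ 5 = 2) : Nonempty (K →+* ℝ) := by
  have h := (nrReal hK hθ).1
  rw [InfinitePlace.nrRealPlaces] at h
  obtain ⟨⟨a, ha⟩, -⟩ := Fintype.card_eq_one_iff.mp h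
  exact ⟨InfinitePlace.embedding_of_isReal ha⟩

theorem discr_le (hK : finrank ℚ K = 5) {θ : K} (hθ : θ ^ 5 = 2) : |discr K| ≤ 50000 := by
  obtain ⟨pb, h1, h2⟩ := exists_pb hK hθ
  have hm : minpoly ℚ θ = X ^ 5 - C 2 := minpoly5 (by simpa using hθ) no5_two
  have hd : Algebra.discr ℚ pb.basis = 50000 := by
    have hn : Algebra.norm ℚ θ = 2 := by
      have := norm5 hK (β := -θ) (c := -2) (by simp [Odd.neg_pow (by decide : Odd 5), hθ])
        (by intro b hb; apply no5_two (-b); rw [Odd.neg_pow (by decide : Odd 5), hb]; norm_num) 0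
      simpa using this
    rw [Algebra.discr_powerBasis_eq_norm, h1, hm, hK]
    have : aeval θ (derivative (X ^ 5 - C 2 : ℚ[X])) = algebraMap ℚ K 5 * θ ^ 4 := by
      simp; norm_num
    rw [this, map_mul, map_pow, hn, Algebra.norm_algebraMap, hK]
    norm_num
  have hc : Fintype.card (Free.ChooseBasisIndex ℤ (𝓞 K)) = 5 := by
    rw [← hK, ← RingOfIntegers.rank, finrank_eq_card_chooseBasisIndex]
  let e : Fin pb.dim ≃ Free.ChooseBasisIndex ℤ (𝓞 K) :=
    Fintype.equivOfCardEq (by rw [hc, Fintype.card_fin, h2])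
  let b := (integralBasis K).reindex e.symm
  have hb : Algebra.discr ℚ b = discr K := by
    rw [coe_discr]
    have : (b : Fin pb.dim → K) = (integralBasis K) ∘ e := by
      ext i; simp [b]
    rw [this]; exact Algebra.discr_reindex ℚ (integralBasis K) e.symm
  have key := Algebra.discr_of_matrix_vecMul (A := ℚ) b (b.toMatrix pb.basis)
  rw [Basis.toMatrix_map_vecMul, hd, hb] at key
  have hInteg : ∃ P : Matrix (Fin pb.dim) (Fin pb.dim) ℤ, b.toMatrix pb.basis = P.map (Int.castRingHom ℚ) := by
    have : ∀ i j, ∃ z : ℤ, b.toMatrix pb.basis i j = z := by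
      intro i j
      have hi : IsIntegral ℤ (pb.basis j) := by
        rw [pb.basis_eq_pow, h1]
        apply IsIntegral.pow
        exact IsIntegral.of_pow (n := 5) (by norm_num) (by rw [hθ]; simpa using isIntegral_algebraMap (R := ℤ) (A := K) (x := (2:ℤ)))
      have := integralBasis_repr_apply K ⟨pb.basis j, hi⟩ (e i)
      refine ⟨(RingOfIntegers.basis K).repr ⟨pb.basis j, hi⟩ (e i), ?_⟩
      rw [Basis.toMatrix_apply, Basis.repr_reindex_apply]
      exact this
    choose P hP using this
    exact ⟨Matrix.of P, by ext i j; rw [hP]; rfl⟩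
  obtain ⟨P, hP⟩ := hInteg
  have hdet : (b.toMatrix pb.basis).det = ((P.det : ℤ) : ℚ) := by
    rw [hP]; exact ((Int.castRingHom ℚ).map_det P).symm
  rw [hdet] at key
  have key' : 50000 = P.det ^ 2 * discr K := by exact_mod_cast key
  have h3 : discr K ∣ 50000 := ⟨P.det ^ 2, by rw [key']; ring⟩
  exact Int.le_of_dvd (by norm_num) ((abs_dvd _ _).2 h3)
end NF
end RC

namespace RC
open Module NumberField
section NF
variable {K : Type*} [Field K] [NumberField K]

theorem absNorm_of (hK : finrank ℚ K = 5) {x : 𝓞 K} {β : 𝓞 K} {a c : ℤ}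
    (hβ : β ^ 5 = (c : 𝓞 K)) (hc : ∀ b : ℚ, b ^ 5 ≠ c) (hx : x = a - β) :
    Ideal.absNorm (Ideal.span {x}) = (a ^ 5 - c).natAbs := by
  rw [Ideal.absNorm_span_singleton]
  congr 1
  have h := norm5 hK (β := (β : K)) (c := (c : ℚ)) (by rw [← map_pow, hβ]; simp) hc (a : ℚ)
  have : (algebraMap ℚ K a - (β : K)) = algebraMap (𝓞 K) K x := by rw [hx]; simp
  rw [this] at h
  have h2 := Algebra.coe_norm_int x
  rw [RingOfIntegers.coe_eq_algebraMap] at h2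
  rw [h] at h2
  exact_mod_cast h2

theorem isPrincipal_of_mem {I : Ideal (𝓞 K)} {x : 𝓞 K} (hI : I ≠ ⊤) (hx : x ∈ I)
    (hp : (Ideal.absNorm (Ideal.span {x})).Prime) : Submodule.IsPrincipal I := by
  have hp' : (Ideal.span {x}).IsPrime := Ideal.isPrime_of_irreducible_absNorm hp
  have hb : Ideal.span {x} ≠ ⊥ := by
    intro h; rw [h] at hp; simp at hp; exact absurd hp (by norm_num)
  have hm : (Ideal.span {x}).IsMaximal := hp'.isMaximal hb
  refine ⟨x, ?_⟩
  exact (hm.eq_of_le hI ((Ideal.span_singleton_le_iff_mem I).2 hx)).symm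

theorem isPID (hK : finrank ℚ K = 5) {θ : 𝓞 K} (hθ : θ ^ 5 = 2) : IsPrincipalIdealRing (𝓞 K) := by
  have hθ' : (θ : K) ^ 5 = 2 := by rw [← map_pow, hθ, map_ofNat]
  have p2 : (Ideal.absNorm (Ideal.span {θ})).Prime := by
    rw [absNorm_of hK (β := - θ) (a := 0) (c := -2)]
    · norm_num
    · rw [Odd.neg_pow (by decide : Odd 5), hθ]; simp
    · intro b hb; apply no5_two (-b); rw [Odd.neg_pow (by decide : Odd 5), hb]; norm_num
    · simp
  have p3 : (Ideal.absNorm (Ideal.span {θ + 1})).Prime := by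
    rw [absNorm_of hK (β := - θ) (a := 1) (c := -2)]
    · norm_num
    · rw [Odd.neg_pow (by decide : Odd 5), hθ]; simp
    · intro b hb; apply no5_two (-b); rw [Odd.neg_pow (by decide : Odd 5), hb]; norm_num
    · simp [add_comm]
  have n5 : Ideal.absNorm (Ideal.span {1 + θ ^ 2}) = 5 := by
    rw [absNorm_of hK (β := - θ ^ 2) (a := 1) (c := -4)]
    · norm_num
    · have : (-θ ^ 2) ^ 5 = - (θ ^ 5) ^ 2 := by ring
      rw [this, hθ]; norm_num
    · intro b hb; apply no5_pow 2 (by norm_num) (-b); rw [Odd.neg_pow (by decide : Odd 5), hb]; norm_num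
    · simp
  have p7 : (Ideal.absNorm (Ideal.span {θ ^ 3 - 1})).Prime := by
    rw [absNorm_of hK (β := - θ ^ 3) (a := -1) (c := -8)]
    · norm_num
    · have : (-θ ^ 3) ^ 5 = - (θ ^ 5) ^ 3 := by ring
      rw [this, hθ]; norm_num
    · intro b hb; apply no5_pow 3 (by norm_num) (-b); rw [Odd.neg_pow (by decide : Odd 5), hb]; norm_num
    · push_cast; ring
  have n65 : Ideal.absNorm (Ideal.span {1 + 2 * θ}) = 65 := by
    rw [absNorm_of hK (β := - (2 * θ)) (a := 1) (c := -64)]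
    · norm_num
    · have : (-(2 * θ)) ^ 5 = - 32 * θ ^ 5 := by ring
      rw [this, hθ]; norm_num
    · intro b hb; apply no5_pow 6 (by norm_num) (-b); rw [Odd.neg_pow (by decide : Odd 5), hb]; norm_num
    · push_cast; ring
  have p13 : (Ideal.absNorm (Ideal.span {1 - θ ^ 2 + θ ^ 4})).Prime := by
    have h1 : Ideal.span {1 + 2 * θ} = Ideal.span {1 + θ ^ 2} * Ideal.span {1 - θ ^ 2 + θ ^ 4} := by
      rw [Ideal.span_singleton_mul_span_singleton]
      congr 2
      linear_combination (-θ) * hθ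
    have h2 := congrArg Ideal.absNorm h1
    rw [map_mul, n65, n5] at h2
    have : Ideal.absNorm (Ideal.span {1 - θ ^ 2 + θ ^ 4}) = 13 := by omega
    rw [this]; norm_num
  apply RingOfIntegers.isPrincipalIdealRing_of_isPrincipal_of_norm_le_of_isPrime
  rintro ⟨I, hI0⟩ hI hIn
  simp only at hI hIn ⊢
  rw [(nrReal hK hθ').2, hK] at hIn
  have hIb : I ≠ ⊥ := mem_nonZeroDivisors_iff_ne_zero.1 hI0
  have hle : Ideal.absNorm I ≤ 13 := by
    have h1 : (√|((discr K : ℤ) : ℝ)| : ℝ) ≤ 224 := by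
      rw [Real.sqrt_le_left (by norm_num)]
      have : ((|discr K| : ℤ) : ℝ) ≤ 50000 := by exact_mod_cast discr_le hK hθ'
      rw [Int.cast_abs] at this
      linarith
    have h2 : (4 / Real.pi) ^ 2 ≤ 1.6228 := by
      have : 4 / Real.pi ≤ 4 / 3.14 := by
        apply div_le_div_of_nonneg_left <;> linarith [Real.pi_gt_d2]
      calc (4 / Real.pi) ^ 2 ≤ (4 / 3.14) ^ 2 := by
            apply pow_le_pow_left₀ _ this; positivity
        _ ≤ _ := by norm_num
    have h3 : (Ideal.absNorm I : ℝ) < 14 := by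
      refine lt_of_le_of_lt hIn ?_
      have h5 : (Nat.factorial 5 : ℝ) = 120 := by norm_num [Nat.factorial]
      rw [h5]
      calc _ ≤ (1.6228 : ℝ) * (120 / (5:ℕ) ^ 5 * 224) := by gcongr
        _ < 14 := by norm_num
    have : Ideal.absNorm I < 14 := by exact_mod_cast h3
    omega
  have : I.IsMaximal := hI.isMaximal hIb
  letI : Field (𝓞 K ⧸ I) := Ideal.Quotient.field I
  have hfin : Finite (𝓞 K ⧸ I) := Ideal.finiteQuotientOfFreeOfNeBot I hIb
  letI : Fintype (𝓞 K ⧸ I) := Fintype.ofFinite _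
  obtain ⟨q, hq⟩ : ∃ q, Ideal.absNorm I = q := ⟨_, rfl⟩
  have hcard : Fintype.card (𝓞 K ⧸ I) = q := by
    rw [← hq, Ideal.absNorm_apply, Submodule.cardQuot_apply, Nat.card_eq_fintype_card]
  have hpp : IsPrimePow q := by rw [← hcard]; exact FiniteField.isPrimePow_card _
  have hq0 : ((q : ℕ) : 𝓞 K ⧸ I) = 0 := by rw [← hcard]; exact Nat.cast_card_eq_zero _
  have ht (x : 𝓞 K ⧸ I) : x ^ q = x := by rw [← hcard]; exact FiniteField.pow_card x
  set t : 𝓞 K ⧸ I := Ideal.Quotient.mk I θ with htdef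
  have h5 : t ^ 5 = 2 := by rw [htdef, ← map_pow, hθ, map_ofNat]
  have htq := ht t
  have hmem : ∀ x, Ideal.Quotient.mk I x = 0 → x ∈ I := fun x => Ideal.Quotient.eq_zero_iff_mem.1
  have hne := hI.ne_top
  have hq13 : q ≤ 13 := hq ▸ hle
  have key2 : (2 : 𝓞 K ⧸ I) = 0 → Submodule.IsPrincipal I := by
    intro h
    apply isPrincipal_of_mem hne _ p2
    apply hmem
    rw [h] at h5
    exact eq_zero_of_pow_eq_zero h5
  have key3 : (3 : 𝓞 K ⧸ I) = 0 → t ^ 9 = t → Submodule.IsPrincipal I := by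
    intro h h9
    apply isPrincipal_of_mem hne _ p3
    apply hmem
    rw [map_add, map_one, ← htdef]
    have hsq : t ^ 2 = 4 := by linear_combination (t^5+2) * h5 - t * h9
    linear_combination h5 - t*(t^2+4)*hsq + (1-5*t)*h
  have hpp' : ∀ a b : ℕ, a.Prime → b.Prime → a ≠ b → ¬ a * b ∣ q := by
    intro a b ha hb hab h
    obtain ⟨p, -, h2⟩ := isPrimePow_iff_unique_prime_dvd.1 hpp
    exact hab ((h2 a ⟨ha, (Dvd.intro _ rfl).trans h⟩).trans (h2 b ⟨hb, (Dvd.intro_left _ rfl).trans h⟩).symm)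
  have n6 : ¬ 2 * 3 ∣ q := hpp' 2 3 (by norm_num) (by norm_num) (by norm_num)
  have n10 : ¬ 2 * 5 ∣ q := hpp' 2 5 (by norm_num) (by norm_num) (by norm_num)
  have n0 : q ≠ 0 := hpp.ne_zero
  have n1 : q ≠ 1 := hpp.ne_one
  clear hpp hpp' hcard hq hle hIn
  have hcases : q = 2 ∨ q = 3 ∨ q = 4 ∨ q = 5 ∨ q = 7 ∨ q = 8 ∨ q = 9 ∨ q = 11 ∨ q = 13 := by omega
  rcases hcases with rfl | rfl | rfl | rfl | rfl | rfl | rfl | rfl | rfl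
  · exact key2 (by exact_mod_cast hq0)
  · refine key3 (by exact_mod_cast hq0) ?_
    linear_combination (t^6 + t^4 + t^2 + 1) * htq
  · refine key2 ?_
    have h : (2 : 𝓞 K ⧸ I) ^ 2 = 0 := by push_cast at hq0; linear_combination hq0
    exact eq_zero_of_pow_eq_zero h
  · apply isPrincipal_of_mem hne _ (n5 ▸ (by norm_num : Nat.Prime 5))
    apply hmem
    rw [map_add, map_one, map_pow, ← htdef]
    push_cast at hq0
    have h2 : t = 2 := by linear_combination h5 - htq
    linear_combination (t + 2) * h2 + hq0
  · apply isPrincipal_of_mem hne _ p7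
    apply hmem
    rw [map_sub, map_one, map_pow, ← htdef]
    push_cast at hq0
    have h2 : 2 * t ^ 2 = t := by linear_combination htq - t^2 * h5
    have h3 : 4 * t = 2 := by linear_combination t^4 * h2 - 2*t*h5 + h5
    have h4 : t = 4 := by linear_combination 2 * h3 - t * hq0
    linear_combination (t^2+4*t+16) * h4 + 9 * hq0
  · refine key2 ?_
    have h : (2 : 𝓞 K ⧸ I) ^ 3 = 0 := by push_cast at hq0; linear_combination hq0
    exact eq_zero_of_pow_eq_zero h
  · refine key3 ?_ htq
    have h : (3 : 𝓞 K ⧸ I) ^ 2 = 0 := by push_cast at hq0; linear_combination hq0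
    exact eq_zero_of_pow_eq_zero h
  · exfalso
    push_cast at hq0
    have h1 : 3 * t = 0 := by linear_combination htq - t * (t^5+2) * h5
    have h2 : (6 : 𝓞 K ⧸ I) = 0 := by linear_combination t^4 * h1 - 3 * h5
    have h3 : (1 : 𝓞 K ⧸ I) = 0 := by linear_combination 2 * h2 - hq0
    exact one_ne_zero h3
  · apply isPrincipal_of_mem hne _ p13
    apply hmem
    rw [map_add, map_sub, map_one, map_pow, map_pow, ← htdef]
    push_cast at hq0
    have h1 : 4 * t^3 = t := by linear_combination htq - t^3 * (t^5+2) * h5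
    have h2 : 8 * t^2 = 2 := by linear_combination t^4 * h1 - 4 * t^2 * h5 + h5
    have h3 : t^2 = 10 := by linear_combination 5 * h2 - 3 * t^2 * hq0
    linear_combination (t^2 + 9) * h3 + 7 * hq0

end NF
end RC

namespace RC
open Module NumberField
section NF
variable {K : Type*} [Field K] [NumberField K]

theorem absNorm_theta (hK : finrank ℚ K = 5) {θ : 𝓞 K} (hθ : θ ^ 5 = 2) :
    Ideal.absNorm (Ideal.span {θ}) = 2 := by
  rw [absNorm_of hK (β := - θ) (a := 0) (c := -2)]
  · norm_num
  · rw [Odd.neg_pow (by decide : Odd 5), hθ]; simp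
  · intro b hb; apply no5_two (-b); rw [Odd.neg_pow (by decide : Odd 5), hb]; norm_num
  · simp

theorem prime_theta (hK : finrank ℚ K = 5) {θ : 𝓞 K} (hθ : θ ^ 5 = 2) : Prime θ := by
  have h0 : θ ≠ 0 := by rintro rfl; norm_num at hθ
  rw [← Ideal.span_singleton_prime h0]
  apply Ideal.isPrime_of_irreducible_absNorm
  rw [absNorm_theta hK hθ]; exact Nat.prime_two

theorem prime_omega (hK : finrank ℚ K = 5) {θ : 𝓞 K} (hθ : θ ^ 5 = 2) : Prime (1 + θ ^ 2) := by
  have n5 : Ideal.absNorm (Ideal.span {1 + θ ^ 2}) = 5 := by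
    rw [absNorm_of hK (β := - θ ^ 2) (a := 1) (c := -4)]
    · norm_num
    · have : (-θ ^ 2) ^ 5 = - (θ ^ 5) ^ 2 := by ring
      rw [this, hθ]; norm_num
    · intro b hb; apply no5_pow 2 (by norm_num) (-b); rw [Odd.neg_pow (by decide : Odd 5), hb]; norm_num
    · simp
  have h0 : 1 + θ ^ 2 ≠ 0 := by intro h; rw [h] at n5; simp at n5
  rw [← Ideal.span_singleton_prime h0]
  apply Ideal.isPrime_of_irreducible_absNorm
  rw [n5]; exact Nat.prime_five

theorem mod_theta (hK : finrank ℚ K = 5) {θ : 𝓞 K} (hθ : θ ^ 5 = 2) (c : 𝓞 K) :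
    θ ∣ c ∨ θ ∣ c - 1 := by
  have hp := prime_theta hK hθ
  have hI : (Ideal.span {θ}).IsPrime := (Ideal.span_singleton_prime hp.ne_zero).2 hp
  have hIb : Ideal.span {θ} ≠ ⊥ := by simpa using hp.ne_zero
  have : (Ideal.span {θ}).IsMaximal := hI.isMaximal hIb
  let _ : Field (𝓞 K ⧸ Ideal.span {θ}) := Ideal.Quotient.field _
  have hfin : Finite (𝓞 K ⧸ Ideal.span {θ}) := Ideal.finiteQuotientOfFreeOfNeBot _ hIb
  let _ : Fintype (𝓞 K ⧸ Ideal.span {θ}) := Fintype.ofFinite _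
  have hcard : Fintype.card (𝓞 K ⧸ Ideal.span {θ}) = 2 := by
    rw [← absNorm_theta hK hθ, Ideal.absNorm_apply, Submodule.cardQuot_apply, Nat.card_eq_fintype_card]
  have h := FiniteField.pow_card (Ideal.Quotient.mk (Ideal.span {θ}) c)
  rw [hcard, ← map_pow, Ideal.Quotient.mk_eq_mk_iff_sub_mem, Ideal.mem_span_singleton] at h
  have h2 : θ ∣ c * (c - 1) := by convert h using 1; ring
  exact hp.dvd_or_dvd h2

/-- square modulo `θ ^ 4` -/
def Sq4 (θ x : 𝓞 K) : Prop := ∃ c : 𝓞 K, θ ^ 4 ∣ x - c ^ 2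

theorem sq4_cases (hK : finrank ℚ K = 5) {θ : 𝓞 K} (hθ : θ ^ 5 = 2) {x : 𝓞 K} (h : Sq4 θ x)
    (hx : ¬ θ ∣ x) :
    θ ^ 4 ∣ x - 1 ∨ θ ^ 4 ∣ x - 1 - θ ^ 2 := by
  obtain ⟨c, hc⟩ := h
  rcases mod_theta hK hθ c with ⟨d, hd⟩ | ⟨d, hd⟩
  · exfalso
    apply hx
    have h1 : θ ∣ x - c ^ 2 := (dvd_pow_self θ (by norm_num)).trans hc
    have h2 : θ ∣ c ^ 2 := by rw [hd]; exact ⟨θ * d ^ 2, by ring⟩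
    simpa using dvd_add h1 h2
  · have hc1 : c = 1 + θ * d := by linear_combination hd
    rcases mod_theta hK hθ d with ⟨e, he⟩ | ⟨e, he⟩
    · left
      have h2 : θ ^ 4 ∣ c ^ 2 - 1 := by
        rw [hc1, he]; exact ⟨e ^ 2 + θ ^ 3 * e, by linear_combination (- θ ^ 2 * e) * hθ⟩
      simpa using dvd_add hc h2
    · right
      have hd1 : d = 1 + θ * e := by linear_combination he
      have h2 : θ ^ 4 ∣ c ^ 2 - 1 - θ ^ 2 := by
        rw [hc1, hd1]
        exact ⟨e ^ 2 + θ ^ 2 + θ ^ 3 * e + θ ^ 4 * e,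
          by linear_combination (- θ - θ ^ 2 * e -θ ^ 3 * e) * hθ⟩
      have := dvd_add hc h2
      convert this using 1; ring

theorem not_dvd_of (hK : finrank ℚ K = 5) {θ : 𝓞 K} (hθ : θ ^ 5 = 2) {x : 𝓞 K} (h : θ ∣ x - 1) :
    ¬ θ ∣ x := by
  intro h'
  apply (prime_theta hK hθ).not_isUnit
  apply isUnit_of_dvd_one
  have := dvd_sub h' h
  simpa using this

theorem not_sq4_e1 (hK : finrank ℚ K = 5) {θ : 𝓞 K} (hθ : θ ^ 5 = 2) : ¬ Sq4 θ (θ - 1) := by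
  intro h
  have h0 := (prime_theta hK hθ).ne_zero
  have hn : ∀ x : 𝓞 K, θ * x ≠ 1 := fun x hx => (prime_theta hK hθ).not_isUnit (IsUnit.of_mul_eq_one x hx)
  have := sq4_cases hK hθ h (not_dvd_of hK hθ ⟨1 - θ ^ 4, by linear_combination hθ⟩)
  rcases this with ⟨d, hd⟩ | ⟨d, hd⟩
  · apply hn (θ ^ 2 * d + θ ^ 3)
    apply mul_left_cancel₀ h0
    linear_combination -hd + hθ
  · apply hn (θ ^ 2 * d + θ ^ 3 + 1)
    apply mul_left_cancel₀ h0
    linear_combination -hd + hθ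

theorem not_sq4_e2 (hK : finrank ℚ K = 5) {θ : 𝓞 K} (hθ : θ ^ 5 = 2) :
    ¬ Sq4 θ (θ ^ 3 + θ ^ 2 - 1) := by
  intro h
  have h0 := (prime_theta hK hθ).ne_zero
  have hn : ∀ x : 𝓞 K, θ * x ≠ 1 := fun x hx => (prime_theta hK hθ).not_isUnit (IsUnit.of_mul_eq_one x hx)
  have := sq4_cases hK hθ h (not_dvd_of hK hθ ⟨θ ^ 2 + θ - θ ^ 4, by linear_combination hθ⟩)
  rcases this with ⟨d, hd⟩ | ⟨d, hd⟩
  · apply hn (θ * d + θ ^ 2 - 1)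
    apply mul_left_cancel₀ (pow_ne_zero 2 h0)
    linear_combination -hd + hθ
  · apply hn (d + θ)
    apply mul_left_cancel₀ (pow_ne_zero 3 h0)
    linear_combination -hd + hθ

theorem not_sq4_e12 (hK : finrank ℚ K = 5) {θ : 𝓞 K} (hθ : θ ^ 5 = 2) :
    ¬ Sq4 θ ((θ - 1) * (θ ^ 3 + θ ^ 2 - 1)) := by
  intro h
  have h0 := (prime_theta hK hθ).ne_zero
  have hn : ∀ x : 𝓞 K, θ * x ≠ 1 := fun x hx => (prime_theta hK hθ).not_isUnit (IsUnit.of_mul_eq_one x hx)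
  have := sq4_cases hK hθ h (not_dvd_of hK hθ ⟨θ ^ 3 - θ - 1, by ring⟩)
  rcases this with ⟨d, hd⟩ | ⟨d, hd⟩
  · apply hn (θ ^ 2 - 1 - θ ^ 2 * d)
    apply mul_left_cancel₀ h0
    linear_combination hd
  · apply hn (θ ^ 2 - 2 - θ ^ 2 * d)
    apply mul_left_cancel₀ h0
    linear_combination hd

theorem real_theta {θ : 𝓞 K} (hθ : θ ^ 5 = 2) (σ : K →+* ℝ) : 1 < σ θ := by
  have h : (σ θ) ^ 5 = 2 := by
    rw [← map_pow, ← map_pow, hθ, map_ofNat, map_ofNat]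
  by_contra hc
  push Not at hc
  have := (Odd.strictMono_pow (R := ℝ) (n := 5) (by decide)).monotone hc
  simp only [h] at this
  norm_num at this

theorem sq4_mul_sq {θ x c : 𝓞 K} (h : Sq4 θ x) : Sq4 θ (x * c ^ 2) := by
  obtain ⟨d, hd⟩ := h
  exact ⟨d * c, by
    have := hd.mul_right (c ^ 2)
    convert this using 1; ring⟩

theorem unit_parity (hK : finrank ℚ K = 5) {θ : 𝓞 K} (hθ : θ ^ 5 = 2) (σ : K →+* ℝ)
    (e1 e2 : (𝓞 K)ˣ) (h1 : (e1 : 𝓞 K) = θ - 1) (h2 : (e2 : 𝓞 K) = θ ^ 3 + θ ^ 2 - 1)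
    (s a b : ℕ) (x : (𝓞 K)ˣ) (hx : 0 < σ (x : 𝓞 K)) (hx4 : Sq4 θ (x : 𝓞 K)) (c : (𝓞 K)ˣ)
    (h : (-1) ^ s * e1 ^ a * e2 ^ b = x * c ^ 2) : Even s ∧ Even a ∧ Even b := by
  have ht := real_theta hθ σ
  have p1 : 0 < σ (e1 : 𝓞 K) := by rw [h1]; simp; linarith
  have p2 : 0 < σ (e2 : 𝓞 K) := by
    rw [h2]; simp; nlinarith [pow_pos (by linarith : 0 < σ (θ : K)) 3]
  have hc : 0 < (σ (c : 𝓞 K)) ^ 2 := by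
    have : σ (c : 𝓞 K) ≠ 0 := by simp
    positivity
  have hv : ((-1) ^ s * (e1 : 𝓞 K) ^ a * (e2 : 𝓞 K) ^ b) = x * c ^ 2 := by
    have := congrArg (fun z : (𝓞 K)ˣ => (z : 𝓞 K)) h
    simpa using this
  have hs : Even s := by
    by_contra hs
    rw [Nat.not_even_iff_odd] at hs
    rw [hs.neg_one_pow] at hv
    have := congrArg (fun z : 𝓞 K => σ z) hv
    simp only [map_mul, map_pow, map_neg, map_one] at this
    have q1 := mul_pos (pow_pos p1 a) (pow_pos p2 b)
    have q2 := mul_pos hx hc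
    linarith
  refine ⟨hs, ?_⟩
  rw [hs.neg_one_pow, one_mul] at hv
  have key : ∀ a' b' ra rb : ℕ, a = 2 * a' + ra → b = 2 * b' + rb →
      Sq4 θ ((θ - 1) ^ ra * (θ ^ 3 + θ ^ 2 - 1) ^ rb) := by
    rintro a' b' ra rb rfl rfl
    have : ((θ - 1) ^ ra * (θ ^ 3 + θ ^ 2 - 1) ^ rb) =
      (x : 𝓞 K) * (c * ((e1⁻¹ : (𝓞 K)ˣ) : 𝓞 K) ^ a' * ((e2⁻¹ : (𝓞 K)ˣ) : 𝓞 K) ^ b') ^ 2 := by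
      have i1 : (e1 : 𝓞 K) ^ a' * ((e1⁻¹ : (𝓞 K)ˣ) : 𝓞 K) ^ a' = 1 := by rw [← mul_pow]; simp
      have i2 : (e2 : 𝓞 K) ^ b' * ((e2⁻¹ : (𝓞 K)ˣ) : 𝓞 K) ^ b' = 1 := by rw [← mul_pow]; simp
      rw [← h1, ← h2]
      calc _ = (e1 : 𝓞 K) ^ ra * (e2 : 𝓞 K) ^ rb * ((e1 : 𝓞 K) ^ a' * ((e1⁻¹ : (𝓞 K)ˣ) : 𝓞 K) ^ a') ^ 2 *
            ((e2 : 𝓞 K) ^ b' * ((e2⁻¹ : (𝓞 K)ˣ) : 𝓞 K) ^ b') ^ 2 := by rw [i1, i2]; ring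
        _ = ((e1 : 𝓞 K) ^ (2 * a' + ra) * (e2 : 𝓞 K) ^ (2 * b' + rb)) *
             (((e1⁻¹ : (𝓞 K)ˣ) : 𝓞 K) ^ a' * ((e2⁻¹ : (𝓞 K)ˣ) : 𝓞 K) ^ b') ^ 2 := by ring
        _ = _ := by rw [hv]; ring
    rw [this]
    exact sq4_mul_sq hx4
  rcases Nat.even_or_odd' a with ⟨a', ha | ha⟩ <;> rcases Nat.even_or_odd' b with ⟨b', hb | hb⟩
  · exact ⟨⟨a', by omega⟩, ⟨b', by omega⟩⟩
  · have := key a' b' 0 1 ha hb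
    simp only [pow_zero, pow_one, one_mul] at this
    exact absurd this (not_sq4_e2 hK hθ)
  · have := key a' b' 1 0 ha hb
    simp only [pow_zero, pow_one, mul_one] at this
    exact absurd this (not_sq4_e1 hK hθ)
  · have := key a' b' 1 1 ha hb
    simp only [pow_one] at this
    exact absurd this (not_sq4_e12 hK hθ)

theorem unit_sq (hK : finrank ℚ K = 5) {θ : 𝓞 K} (hθ : θ ^ 5 = 2) (σ : K →+* ℝ)
    (x : (𝓞 K)ˣ) (hx : 0 < σ (x : 𝓞 K)) (hx4 : Sq4 θ (x : 𝓞 K)) : ∃ y : (𝓞 K)ˣ, x = y ^ 2 := by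
  have hθ' : (θ : K) ^ 5 = 2 := by rw [← map_pow, hθ, map_ofNat]
  obtain ⟨e1, he1⟩ : ∃ e1 : (𝓞 K)ˣ, (e1 : 𝓞 K) = θ - 1 :=
    ⟨Units.mkOfMulEqOne (θ - 1) (1 + θ + θ ^ 2 + θ ^ 3 + θ ^ 4) (by linear_combination hθ), rfl⟩
  obtain ⟨e2, he2⟩ : ∃ e2 : (𝓞 K)ˣ, (e2 : 𝓞 K) = θ ^ 3 + θ ^ 2 - 1 :=
    ⟨Units.mkOfMulEqOne (θ ^ 3 + θ ^ 2 - 1) (-1 + θ ^ 2 - θ ^ 3 + θ ^ 4)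
    (by linear_combination θ ^ 2 * hθ), rfl⟩
  let S : Subgroup (𝓞 K)ˣ := (powMonoidHom 2 : (𝓞 K)ˣ →* (𝓞 K)ˣ).range
  have hS : ∀ z, z ∈ S ↔ ∃ y, y ^ 2 = z := by intro z; rfl
  have hrank : Units.rank K = 2 := by
    rw [Units.rank, InfinitePlace.card_eq_nrRealPlaces_add_nrComplexPlaces, (nrReal hK hθ').1, (nrReal hK hθ').2]
  let φ : Fin 2 × (Fin (Units.rank K) → Fin 2) → (𝓞 K)ˣ ⧸ S := fun p =>
    QuotientGroup.mk ((-1) ^ (p.1 : ℕ) * ∏ i, (Units.fundSystem K i) ^ (p.2 i : ℕ))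
  have hφ : Function.Surjective φ := by
    intro q
    obtain ⟨z, rfl⟩ := QuotientGroup.mk_surjective q
    obtain ⟨⟨ζ, e⟩, he, -⟩ := Units.exist_unique_eq_mul_prod K z
    simp only at he
    have hr : ∀ n : ℤ, ∃ r : Fin 2, ∃ m : ℤ, n = r + 2 * m := by
      intro n
      rcases Int.even_or_odd' n with ⟨k, hk | hk⟩
      · exact ⟨0, k, by simp [hk]⟩
      · exact ⟨1, k, by simp [hk]; ring⟩
    choose r m hrm using hr
    have hz : ∃ s : Fin 2, (ζ : (𝓞 K)ˣ) = (-1) ^ (s : ℕ) := by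
      rcases Units.torsion_eq_one_or_neg_one_of_odd_finrank (by rw [hK]; decide) ζ with h | h
      · exact ⟨0, by simp [h]⟩
      · exact ⟨1, by simp [h]⟩
    obtain ⟨s, hs⟩ := hz
    refine ⟨(s, fun i => r (e i)), ?_⟩
    simp only [φ]
    rw [QuotientGroup.eq, hS, he, hs]
    refine ⟨∏ i, (Units.fundSystem K i) ^ (m (e i)), ?_⟩
    rw [← Finset.prod_pow, mul_inv, mul_mul_mul_comm, inv_mul_cancel, one_mul, ← Finset.prod_inv_distrib,
      ← Finset.prod_mul_distrib]
    apply Finset.prod_congr rfl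
    intro i _
    have hzz : Units.fundSystem K i ^ (e i) =
        Units.fundSystem K i ^ (r (e i) : ℕ) * (Units.fundSystem K i ^ (m (e i))) ^ 2 := by
      conv_lhs => rw [hrm (e i)]
      rw [zpow_add, zpow_natCast, mul_comm 2, zpow_mul]
      norm_cast
    rw [hzz, inv_mul_cancel_left]
  let ψ : Fin 2 × Fin 2 × Fin 2 → (𝓞 K)ˣ ⧸ S := fun p =>
    QuotientGroup.mk ((-1) ^ (p.1 : ℕ) * e1 ^ (p.2.1 : ℕ) * e2 ^ (p.2.2 : ℕ))
  have hψ : Function.Injective ψ := by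
    rintro ⟨s, a, b⟩ ⟨s', a', b'⟩ h
    simp only [ψ] at h
    rw [QuotientGroup.eq, hS] at h
    obtain ⟨y, hy⟩ := h
    have := unit_parity hK hθ σ e1 e2 he1 he2 (s + s') (a + a') (b + b') 1 (by simp)
      ⟨1, by simp⟩ (y * ((-1) ^ (s : ℕ) * e1 ^ (a : ℕ) * e2 ^ (b : ℕ))) (by
        rw [mul_pow, hy, one_mul]
        have hg : ∀ A B : (𝓞 K)ˣ, A⁻¹ * B * A ^ 2 = A * B := by
          intro A B
          rw [mul_assoc, pow_two, ← mul_assoc B, mul_comm B, mul_assoc, inv_mul_cancel_left, mul_comm]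
        have hg2 : ∀ p q r p' q' r' : (𝓞 K)ˣ, (p * p') * (q * q') * (r * r') =
            (p * q * r) * (p' * q' * r') := by
          intro p q r p' q' r'
          rw [mul_mul_mul_comm (p * q), mul_mul_mul_comm p q]
        rw [hg, pow_add, pow_add, pow_add, hg2])
    obtain ⟨i1, i2, i3⟩ := this
    rw [Nat.even_iff] at i1 i2 i3
    simp only [Prod.mk.injEq, Fin.ext_iff]
    omega
  have hsurj : Function.Surjective ψ := by
    have hfin : Finite ((𝓞 K)ˣ ⧸ S) := Finite.of_surjective φ hφ
    have c1 : Nat.card ((𝓞 K)ˣ ⧸ S) ≤ 8 := by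
      have := Nat.card_le_card_of_surjective φ hφ
      simpa [hrank] using this
    have c2 := Nat.card_le_card_of_injective ψ hψ
    simp at c2
    have := (Nat.bijective_iff_injective_and_card ψ).2 ⟨hψ, by simp; omega⟩
    exact this.2
  obtain ⟨⟨s, a, b⟩, h⟩ := hsurj (QuotientGroup.mk x)
  simp only [ψ] at h
  have hh := h
  rw [eq_comm, QuotientGroup.eq, hS] at h
  obtain ⟨y, hy⟩ := h
  have := unit_parity hK hθ σ e1 e2 he1 he2 s a b x hx hx4 y (by rw [hy, mul_inv_cancel_left])
  obtain ⟨i1, i2, i3⟩ := this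
  rw [Nat.even_iff] at i1 i2 i3
  have j1 : (s : ℕ) = 0 := by omega
  have j2 : (a : ℕ) = 0 := by omega
  have j3 : (b : ℕ) = 0 := by omega
  rw [j1, j2, j3] at hh
  simp only [pow_zero, mul_one] at hh
  rw [QuotientGroup.eq, hS] at hh
  obtain ⟨z, hz⟩ := hh
  exact ⟨z, by rw [hz]; simp⟩
end NF
end RC

namespace RC
/-- the quintic `4 (1 + X) ^ 5 + 1` -/
noncomputable def Fz : ℤ[X] := 4 * (1 + X) ^ 5 + 1

theorem descent_div {F : Type*} [Field F] {U V Q m : F[X]} (h5 : (5 : F) ≠ 0)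
    (hU0 : U ≠ 0) (hU : U.natDegree ≤ 2) (hV : V.natDegree ≤ 3)
    (hm : 0 < m.natDegree) (hmU : m ∣ U) (hmV : m ∣ V) (hmQ : m ∣ Q)
    (hV3 : U.coeff 2 = 0 → V.coeff 3 = 0)
    (h : 5 * V ^ 2 + U * Q = 0) : ∃ a b : F, V = U * (C a * X + C b) := by
  obtain ⟨U', rfl⟩ := hmU
  obtain ⟨V', rfl⟩ := hmV
  obtain ⟨Q', rfl⟩ := hmQ
  have hm0 : m ≠ 0 := left_ne_zero_of_mul hU0
  have hU'0 : U' ≠ 0 := right_ne_zero_of_mul hU0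
  have hd : m.natDegree + U'.natDegree ≤ 2 := by rwa [← natDegree_mul hm0 hU'0]
  have h' : 5 * V' ^ 2 = - (U' * Q') := by
    apply mul_left_cancel₀ (pow_ne_zero 2 hm0)
    linear_combination h
  have hdvd : U' ∣ V' := by
    have h1 : U' ∣ C 5 * V' ^ 2 := by
      rw [show (C 5 : F[X]) = 5 from rfl, h']
      exact (Dvd.intro _ rfl).neg_right
    have h2 : U' ∣ V' ^ 2 := by
      rwa [(isUnit_C.2 (isUnit_iff_ne_zero.2 h5)).dvd_mul_left] at h1
    rcases Nat.eq_zero_or_pos U'.natDegree with h0 | h0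
    · have : IsUnit U' := by
        rw [Polynomial.isUnit_iff_degree_eq_zero, degree_eq_natDegree hU'0, h0]; rfl
      exact this.dvd
    · have : Irreducible U' := irreducible_of_degree_eq_one (by
        rw [degree_eq_natDegree hU'0]; have : U'.natDegree = 1 := by omega
        rw [this]; rfl)
      exact this.prime.dvd_of_dvd_pow h2
  obtain ⟨L, rfl⟩ := hdvd
  rw [← mul_assoc] at *
  have hL : L.natDegree ≤ 1 := by
    by_cases hL0 : L = 0
    · simp [hL0]
    have hs := natDegree_mul hU0 hL0
    rcases Nat.lt_or_ge (m * U').natDegree 2 with h2 | h2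
    · have hc : (m * U').coeff 2 = 0 := coeff_eq_zero_of_natDegree_lt h2
      have h3 := hV3 hc
      have h4 : (m * U' * L).natDegree ≤ 2 := by
        by_contra hcon
        have : (m * U' * L).natDegree = 3 := by omega
        have h5 : (m * U' * L).leadingCoeff = 0 := by rw [leadingCoeff, this, h3]
        rw [leadingCoeff_eq_zero] at h5
        exact mul_ne_zero hU0 hL0 h5
      have : 0 < (m * U').natDegree := by rw [natDegree_mul hm0 hU'0]; omega
      omega
    · omega
  obtain ⟨a, b, rfl⟩ := exists_eq_X_add_C_of_natDegree_le_one hL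
  exact ⟨a, b, rfl⟩

theorem dvd_of_map_eq_zero {l : ℕ} {P : ℤ[X]} (h : P.map (Int.castRingHom (ZMod l)) = 0) :
    ∃ P', P = C (l : ℤ) * P' ∧ P'.natDegree ≤ P.natDegree := by
  have h1 : (C (l:ℤ)) ∣ P := by
    rw [C_dvd_iff_dvd_coeff]
    intro i
    have := congrArg (fun p => p.coeff i) h
    simp only [coeff_map, coeff_zero, eq_intCast] at this
    exact (ZMod.intCast_zmod_eq_zero_iff_dvd _ _).1 this
  obtain ⟨P', hP'⟩ := h1
  by_cases hl : (l : ℤ) = 0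
  · refine ⟨0, ?_, by simp⟩
    rw [hP', hl]; simp
  exact ⟨P', hP', by rw [hP', natDegree_C_mul hl]⟩

theorem descent {k : Type*} [Field k] [Finite k] (ξ : k) (hF : aeval ξ Fz = 0)
    (hF' : aeval ξ (derivative Fz) ≠ 0) (h5 : (5 : k) ≠ 0) {U V Q : ℤ[X]} {d : ℤ} (hd : d ≠ 0)
    (hU : U.natDegree ≤ 2) (hV : V.natDegree ≤ 3) (hQ : Q.natDegree ≤ 4)
    (hUp : ∀ l : ℕ, l.Prime → U.map (Int.castRingHom (ZMod l)) ≠ 0)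
    (h : C d ^ 2 * Fz - 5 * V ^ 2 = U * Q) (h35 : -5 * V.coeff 3 ^ 2 = U.coeff 2 * Q.coeff 4)
    (hUξ : aeval ξ U = 0) (hQξ : aeval ξ Q = 0) :
    ∃ (d' : ℤ) (V' Q' : ℤ[X]), d' ≠ 0 ∧ d'.natAbs < d.natAbs ∧ V'.natDegree ≤ 3 ∧ Q'.natDegree ≤ 4 ∧
      C d' ^ 2 * Fz - 5 * V' ^ 2 = U * Q' := by
  obtain ⟨l, hl⟩ := CharP.exists k
  have hlp : l.Prime := (CharP.char_is_prime_or_zero k l).resolve_right (CharP.char_ne_zero_of_finite k l)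
  haveI : Fact l.Prime := ⟨hlp⟩
  let _ : Algebra (ZMod l) k := ZMod.algebra k l
  have hVξ : aeval ξ V = 0 := by
    have := congrArg (aeval ξ) h
    simp only [map_sub, map_mul, hF, hUξ, map_pow] at this
    have h6 : (5 : k) * (aeval ξ V) ^ 2 = 0 := by
      have e5 : aeval ξ (5 : ℤ[X]) = (5 : k) := map_ofNat _ 5
      rw [e5] at this
      linear_combination -this
    simpa [h5] using h6
  have hdk : (d : k) = 0 := by
    have := congrArg (fun P => aeval ξ (derivative P)) h
    have h6 : (d : k) ^ 2 * aeval ξ (derivative Fz) = 0 := by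
      simp only [derivative_sub, derivative_mul, derivative_pow, derivative_C, map_sub, map_mul,
        map_add, map_pow, hVξ, hUξ, hQξ, hF] at this
      simp at this
      simpa using this
    simpa [hF'] using h6
  have hld : (l : ℤ) ∣ d := (CharP.intCast_eq_zero_iff k l d).1 hdk
  let r := Int.castRingHom (ZMod l)
  have hae : ∀ P : ℤ[X], aeval ξ (P.map r) = aeval ξ P := by
    intro P
    rw [aeval_def, eval₂_map, aeval_def]
    congr 1
    exact RingHom.ext_int _ _
  have hInteg : IsIntegral (ZMod l) ξ := Algebra.IsIntegral.isIntegral ξ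
  have hd0 : r d = 0 := by simpa [r] using (ZMod.intCast_zmod_eq_zero_iff_dvd d l).2 hld
  have h5l : (5 : ZMod l) ≠ 0 := by
    intro h0
    apply h5
    have := congrArg (algebraMap (ZMod l) k) h0
    rw [map_ofNat, map_zero] at this
    exact this
  obtain ⟨a, b, hab⟩ : ∃ a b, V.map r = U.map r * (C a * X + C b) := by
    apply descent_div (Q := Q.map r) (m := minpoly (ZMod l) ξ) h5l (hUp l hlp)
      (natDegree_map_le.trans hU) (natDegree_map_le.trans hV) (minpoly.natDegree_pos hInteg)
    · exact minpoly.dvd _ _ (by rw [hae, hUξ])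
    · exact minpoly.dvd _ _ (by rw [hae, hVξ])
    · exact minpoly.dvd _ _ (by rw [hae, hQξ])
    · intro h2
      have := congrArg r h35
      rw [coeff_map] at h2 ⊢
      change r (U.coeff 2) = 0 at h2
      have e5 : r (-5) = -5 := by simp [r]
      rw [map_mul, map_mul, map_pow, h2, zero_mul, e5] at this
      change r (V.coeff 3) = 0
      rcases mul_eq_zero.1 this with h7 | h7
      · exact absurd (neg_eq_zero.1 h7) h5l
      · exact pow_eq_zero_iff (two_ne_zero) |>.1 h7
    · have := congrArg (Polynomial.map r) h
      simp only [Polynomial.map_sub, Polynomial.map_mul, Polynomial.map_pow, map_C, hd0] at this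
      simp at this
      linear_combination -this
  obtain ⟨a', rfl⟩ := ZMod.intCast_surjective a
  obtain ⟨b', rfl⟩ := ZMod.intCast_surjective b
  set L : ℤ[X] := C a' * X + C b' with hL
  have hLd : L.natDegree ≤ 1 := natDegree_linear_le
  have hULd : (U * L).natDegree ≤ 3 := natDegree_mul_le.trans (by omega)
  obtain ⟨V', hV', hV'd⟩ := dvd_of_map_eq_zero (l := l) (P := V - U * L) (by
    change Polynomial.map r _ = 0
    rw [Polynomial.map_sub, Polynomial.map_mul, hab, hL]; simp [r])
  have hV'3 : V'.natDegree ≤ 3 := hV'd.trans ((natDegree_sub_le _ _).trans (by omega))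
  obtain ⟨d', rfl⟩ := hld
  have hl0 : (l : ℤ) ≠ 0 := by exact_mod_cast hlp.ne_zero
  have hCl : (C (l : ℤ)) ≠ 0 := by simpa using hlp.ne_zero
  set Q1 := Q + 5 * U * L ^ 2 + 10 * C (l : ℤ) * L * V' with hQ1
  have e1 : C (l : ℤ) * (C (l : ℤ) * (C d' ^ 2 * Fz - 5 * V' ^ 2)) = U * Q1 := by
    have hVV : V = U * L + C (l : ℤ) * V' := by linear_combination hV'
    rw [hQ1]
    rw [hVV, C_mul] at h
    linear_combination h
  have hdeg1 : Q1.natDegree ≤ 4 := by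
    rw [hQ1]
    have t1 : (5 * U * L ^ 2).natDegree ≤ 4 := by
      refine natDegree_mul_le.trans ?_
      have q1 : (5 * U).natDegree ≤ 2 := (natDegree_C_mul_le (5:ℤ) U).trans hU
      have q2 : (L ^ 2).natDegree ≤ 2 := natDegree_pow_le.trans (by omega)
      omega
    have t2 : (10 * C (l : ℤ) * L * V').natDegree ≤ 4 := by
      refine natDegree_mul_le.trans ?_
      have q1 : (10 * C (l : ℤ) * L).natDegree ≤ 1 := by
        have : (10 * C (l : ℤ) * L) = C (10 * (l:ℤ)) * L := by rw [C_mul]; rfl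
        rw [this]; exact (natDegree_C_mul_le _ L).trans hLd
      omega
    exact natDegree_add_le_of_degree_le (natDegree_add_le_of_degree_le hQ t1) t2
  have key : ∀ P R : ℤ[X], C (l:ℤ) * P = U * R → ∃ R', R = C (l : ℤ) * R' ∧ R'.natDegree ≤ R.natDegree := by
    intro P R hPR
    apply dvd_of_map_eq_zero
    have := congrArg (Polynomial.map (Int.castRingHom (ZMod l))) hPR
    rw [Polynomial.map_mul, Polynomial.map_mul, map_C] at this
    have h0 : Int.castRingHom (ZMod l) (l : ℤ) = 0 := by simp
    rw [h0, C_0, zero_mul] at this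
    exact (mul_eq_zero.1 this.symm).resolve_left (hUp l hlp)
  obtain ⟨Q2, hQ2, hQ2d⟩ := key _ _ e1
  rw [hQ2, mul_left_comm U] at e1
  have e2 := mul_left_cancel₀ hCl e1
  obtain ⟨Q3, hQ3, hQ3d⟩ := key _ _ e2
  rw [hQ3, mul_left_comm U] at e2
  have e3 := mul_left_cancel₀ hCl e2
  refine ⟨d', V', Q3, right_ne_zero_of_mul hd, ?_, hV'3, by omega, e3⟩
  rw [Int.natAbs_mul]
  have : 0 < d'.natAbs := Int.natAbs_pos.2 (right_ne_zero_of_mul hd)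
  have h2 := hlp.two_le
  simp only [Int.natAbs_natCast]
  nlinarith
end RC

namespace RC
open Module NumberField

theorem ufd_core {R : Type*} [CommRing R] [IsDomain R] [UniqueFactorizationMonoid R] {p1 p2 : R}
    (h1 : Prime p1) (h2 : Prime p2) (x : R) :
    ∀ (y z s : R), x ≠ 0 → x * y = s * z ^ 2 → (∀ π, Prime π → π ∣ s → π ∣ p1 ∨ π ∣ p2) →
      (∀ π, Prime π → π ∣ x → π ∣ y → π ∣ p1 ∨ π ∣ p2) →
      ∃ (ε : Rˣ) (a b : ℕ) (c : R), x = ε * p1 ^ a * p2 ^ b * c ^ 2 := by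
  refine WellFounded.induction (_root_.wellFounded_dvdNotUnit (α := R)) (C := fun x => ∀ (y z s : R), x ≠ 0 → x * y = s * z ^ 2 → (∀ π, Prime π → π ∣ s → π ∣ p1 ∨ π ∣ p2) →
      (∀ π, Prime π → π ∣ x → π ∣ y → π ∣ p1 ∨ π ∣ p2) →
      ∃ (ε : Rˣ) (a b : ℕ) (c : R), x = ε * p1 ^ a * p2 ^ b * c ^ 2) x ?_
  clear x
  intro x IH y z s hx hxy hs hc
  by_cases hu : IsUnit x
  · exact ⟨hu.unit, 0, 0, 1, by simp⟩
  obtain ⟨π, hπi, hπ⟩ := WfDvdMonoid.exists_irreducible_factor hu hx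
  have hπp : Prime π := hπi.prime
  by_cases hb : π ∣ p1 ∨ π ∣ p2
  · have key : ∀ p, Prime p → π ∣ p → (p = p1 ∨ p = p2) →
        ∃ x', x = p * x' ∧ ∃ (ε : Rˣ) (a b : ℕ) (c : R), x' = ε * p1 ^ a * p2 ^ b * c ^ 2 := by
      intro p hp hπq hpp
      have hpx : p ∣ x := ((hπp.associated_of_dvd hp hπq).symm.dvd).trans hπ
      obtain ⟨x', rfl⟩ := hpx
      have hx' := right_ne_zero_of_mul hx
      refine ⟨x', rfl, IH x' ⟨hx', p, hp.not_isUnit, mul_comm _ _⟩ (p * y) z s hx' (by rw [← hxy]; ring) hs ?_⟩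
      intro q hq hqx hqy
      rcases hq.dvd_or_dvd hqy with h | h
      · rcases hpp with rfl | rfl
        · exact Or.inl h
        · exact Or.inr h
      · exact hc q hq (hqx.mul_left _) h
    rcases hb with hb | hb
    · obtain ⟨x', rfl, ε, a, b, c, rfl⟩ := key p1 h1 hb (Or.inl rfl)
      exact ⟨ε, a + 1, b, c, by ring⟩
    · obtain ⟨x', rfl, ε, a, b, c, rfl⟩ := key p2 h2 hb (Or.inr rfl)
      exact ⟨ε, a, b + 1, c, by ring⟩
  · have hπs : ¬ π ∣ s := fun h => hb (hs π hπp h)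
    have hπy : ¬ π ∣ y := fun h => hb (hc π hπp hπ h)
    obtain ⟨x', rfl⟩ := hπ
    have hz : π ∣ z := by
      have : π ∣ s * z ^ 2 := by rw [← hxy, mul_assoc]; exact Dvd.intro _ rfl
      exact hπp.dvd_of_dvd_pow ((hπp.dvd_or_dvd this).resolve_left hπs)
    obtain ⟨z', rfl⟩ := hz
    have e1 : x' * y = π * (s * z' ^ 2) := by
      apply mul_left_cancel₀ hπp.ne_zero
      linear_combination hxy
    have hx' : π ∣ x' := by
      have : π ∣ x' * y := by rw [e1]; exact Dvd.intro _ rfl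
      exact (hπp.dvd_or_dvd this).resolve_right hπy
    obtain ⟨x'', rfl⟩ := hx'
    have e2 : x'' * y = s * z' ^ 2 := by
      apply mul_left_cancel₀ hπp.ne_zero
      linear_combination e1
    have hx'' := right_ne_zero_of_mul (right_ne_zero_of_mul hx)
    obtain ⟨ε, a, b, c, h⟩ := IH x'' ⟨hx'', π * π, by
        rw [isUnit_mul_self_iff]; exact hπp.not_isUnit, by ring⟩ y z' s hx'' e2 hs
      (fun q hq hqx hqy => hc q hq (hqx.trans ⟨π * π, by ring⟩) hqy)
    exact ⟨ε, a, b, π * c, by rw [h]; ring⟩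

section NF
variable {K : Type*} [Field K] [NumberField K]

theorem sq4_of_mul (hK : finrank ℚ K = 5) {θ : 𝓞 K} (hθ : θ ^ 5 = 2) {x c : 𝓞 K} (hc : ¬ θ ∣ c)
    (h : Sq4 θ (x * c ^ 2)) : Sq4 θ x := by
  have hcop : ∃ d e, d * c + e * θ ^ 4 = 1 := by
    have : IsCoprime c (θ ^ 4) := by
      apply IsCoprime.pow_right
      rcases mod_theta hK hθ c with h1 | ⟨e, he⟩
      · exact absurd h1 hc
      · exact ⟨1, -e, by linear_combination he⟩
    exact this
  obtain ⟨d, e, hde⟩ := hcop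
  obtain ⟨s, f, hs⟩ := h
  refine ⟨s * d, f * d ^ 2 + x * e * (1 + c * d), ?_⟩
  linear_combination d ^ 2 * hs - x * (1 + d * c) * hde

theorem omega5 {θ : 𝓞 K} (hθ : θ ^ 5 = 2) :
    (1 + θ ^ 2) ^ 5 = 5 * (1 + θ ^ 2 + 2 * θ ^ 4 + 2 * θ ^ 6 + θ ^ 8) := by
  linear_combination (θ ^ 5 + 2) * hθ

theorem dvd_omega_of_five {θ : 𝓞 K} (hθ : θ ^ 5 = 2) {π : 𝓞 K} (hπ : Prime π) (h : π ∣ 5) :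
    π ∣ 1 + θ ^ 2 := by
  apply hπ.dvd_of_dvd_pow (n := 5)
  rw [omega5 hθ]; exact h.mul_right _

theorem H1core (hK : finrank ℚ K = 5) {θ : 𝓞 K} (hθ : θ ^ 5 = 2) {δ y z : 𝓞 K} (hδ0 : ¬ θ ∣ δ)
    (h : δ * y = -5 * z ^ 2)
    (hc : ∀ π, Prime π → π ∣ δ → π ∣ y → π ∣ θ ∨ π ∣ 1 + θ ^ 2) (h4 : Sq4 θ δ) :
    ∃ (κ : ℤ) (γ : 𝓞 K), κ ≠ 0 ∧ κ * δ = γ ^ 2 := by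
  have := isPID hK hθ
  have hpθ := prime_theta hK hθ
  obtain ⟨σ⟩ := exists_real (K := K) hK (θ := (θ : K)) (by rw [← map_pow, hθ, map_ofNat])
  obtain ⟨ε, a, b, c, hδ⟩ := ufd_core hpθ (prime_omega hK hθ) δ y z (-5)
    (by rintro rfl; exact hδ0 (dvd_zero _)) h (fun π hπ hd => Or.inr (dvd_omega_of_five hθ hπ (by rwa [dvd_neg] at hd))) hc
  have ha : a = 0 := by
    by_contra h0
    apply hδ0
    rw [hδ]
    exact (((dvd_pow_self θ h0).mul_left _).mul_right _).mul_right _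
  subst ha
  have s1 : ∃ (κ : ℤ) (ε : (𝓞 K)ˣ) (c : 𝓞 K), κ ≠ 0 ∧ (∃ j : 𝓞 K, (κ : 𝓞 K) - 1 = θ ^ 4 * j) ∧ κ * δ = ε * c ^ 2 := by
    rcases Nat.even_or_odd' b with ⟨b', rfl | rfl⟩
    · exact ⟨1, ε, (1 + θ ^ 2) ^ b' * c, by norm_num, ⟨0, by simp⟩, by rw [hδ]; push_cast; ring⟩
    · let ε5 : (𝓞 K)ˣ := Units.mkOfMulEqOne (-3 - θ ^ 2 + 3 * θ ^ 4 - 3 * θ ^ 6 + 2 * θ ^ 8)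
        (1 + θ ^ 2 + 2 * θ ^ 4 + 2 * θ ^ 6 + θ ^ 8) (by
          linear_combination (θ ^ 5 + 2) * (1 + θ ^ 2 + θ ^ 4 + 2 * θ ^ 6) * hθ)
      refine ⟨5, ε * ε5, (1 + θ ^ 2) ^ (b' + 3) * c, by norm_num, ⟨θ ^ 6, ?_⟩, ?_⟩
      · push_cast; linear_combination - (θ ^ 5 + 2) * hθ
      · have e5 : (ε5 : 𝓞 K) * (1 + θ ^ 2) ^ 5 = 5 := by
          rw [omega5 hθ, mul_left_comm]
          have : (ε5 : 𝓞 K) * (1 + θ ^ 2 + 2 * θ ^ 4 + 2 * θ ^ 6 + θ ^ 8) = 1 := ε5.mul_inv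
          rw [this, mul_one]
        rw [hδ]; push_cast
        rw [← e5]; ring
  obtain ⟨κ, ε, c, hκ, ⟨j, hj⟩, hκδ⟩ := s1
  have hκ4 : Sq4 θ (κ * δ) := by
    obtain ⟨s, f, hs⟩ := h4
    exact ⟨s, f + j * δ, by linear_combination hs + δ * hj⟩
  have s2 : ∃ (κ : ℤ) (ε : (𝓞 K)ˣ), κ ≠ 0 ∧ Sq4 θ (κ * δ) ∧ κ * δ = ε * c ^ 2 ∧ 0 < σ (ε : 𝓞 K) := by
    have : σ (ε : 𝓞 K) ≠ 0 := by
      intro h0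
      have := (map_eq_zero σ).1 h0
      exact ε.ne_zero (by exact_mod_cast this)
    rcases lt_or_gt_of_ne this with h0 | h0
    · refine ⟨-κ, -ε, by simpa using hκ, ?_, by push_cast; linear_combination -hκδ, by simpa using h0⟩
      obtain ⟨s, f, hs⟩ := hκ4
      exact ⟨s, f - θ * κ * δ, by push_cast; linear_combination hs + κ * δ * hθ⟩
    · exact ⟨κ, ε, hκ, hκ4, hκδ, h0⟩
  obtain ⟨κ', ε', hκ', hs4, hκδ', hpos⟩ := s2
  have hcθ : ¬ θ ∣ c := by
    intro hd
    have : θ ∣ κ * δ := by rw [hκδ]; exact (dvd_pow hd two_ne_zero).mul_left _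
    rcases hpθ.dvd_or_dvd this with h | h
    · have : θ ∣ 1 := by
        have h2 : (1 : 𝓞 K) = κ - θ * (θ ^ 3 * j) := by linear_combination -hj
        rw [h2]; exact dvd_sub h (Dvd.intro _ rfl)
      exact hpθ.not_isUnit (isUnit_of_dvd_one this)
    · exact hδ0 h
  rw [hκδ'] at hs4
  obtain ⟨w, rfl⟩ := unit_sq hK hθ σ ε' hpos (sq4_of_mul hK hθ hcθ hs4)
  exact ⟨κ', w * c, hκ', by rw [hκδ']; push_cast; ring⟩
end NF
end RC

namespace RC
open Module NumberField

/-- homogenised evaluation at `(-(1+η) : η)` -/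
noncomputable def hat {R : Type*} [CommRing R] (η : R) (n : ℕ) (P : ℤ[X]) : R :=
  ∑ i ∈ Finset.range (n + 1), (P.coeff i : R) * (-(1 + η)) ^ i * η ^ (n - i)

theorem hat_map {R k : Type*} [CommRing R] [Field k] (φ : R →+* k) (η : R) (hη : φ η ≠ 0) (n : ℕ)
    (P : ℤ[X]) (hP : P.natDegree ≤ n) :
    φ (hat η n P) = φ η ^ n * aeval (-(1 + φ η) / φ η) P := by
  rw [aeval_eq_sum_range' (Nat.lt_succ_of_le hP), hat, map_sum, Finset.mul_sum]
  apply Finset.sum_congr rfl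
  intro i hi
  have hi' : i ≤ n := Nat.lt_succ_iff.1 (Finset.mem_range.1 hi)
  simp only [map_mul, map_pow, map_neg, map_add, map_one, map_intCast, zsmul_eq_mul, div_pow]
  obtain ⟨j, rfl⟩ := Nat.exists_eq_add_of_le hi'
  rw [Nat.add_sub_cancel_left, pow_add]
  field_simp

theorem aeval_Fz {k : Type*} [Field k] (η : k) (hη : η ≠ 0) (h : η ^ 5 = 4) :
    aeval (-(1 + η) / η) Fz = 0 := by
  have h1 : (1 + -(1 + η) / η) = - η⁻¹ := by field_simp; ring
  have : aeval (-(1 + η) / η) Fz = 4 * (1 + -(1 + η) / η) ^ 5 + 1 := by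
    have e4 : aeval (-(1 + η) / η) (4 : ℤ[X]) = 4 := map_ofNat _ 4
    rw [Fz, map_add, map_mul, e4]; simp
  rw [this, h1, ← h]
  field_simp
  ring

theorem aeval_dFz {k : Type*} [Field k] (η : k) (hη : η ≠ 0) (h2 : (2 : k) ≠ 0) (h5 : (5 : k) ≠ 0) :
    aeval (-(1 + η) / η) (derivative Fz) ≠ 0 := by
  have h1 : (1 + -(1 + η) / η) = - η⁻¹ := by field_simp; ring
  have h3 : derivative Fz = 20 * (1 + X) ^ 4 := by
    rw [Fz]; simp only [derivative_add, derivative_mul, derivative_pow, derivative_X, derivative_one, derivative_ofNat]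
    simp; ring
  have : aeval (-(1 + η) / η) (derivative Fz) = 2 * 2 * 5 * (1 + -(1 + η) / η) ^ 4 := by
    have e4 : aeval (-(1 + η) / η) (20 : ℤ[X]) = 20 := map_ofNat _ 20
    rw [h3, map_mul, e4]; simp; norm_num
  rw [this, h1]
  have := inv_ne_zero hη
  simp [h2, h5, hη]

theorem coeff_six {U V Q : ℤ[X]} {d : ℤ}
    (hU : U.natDegree ≤ 2) (hV : V.natDegree ≤ 3) (hQ : Q.natDegree ≤ 4)
    (h : C d ^ 2 * Fz - 5 * V ^ 2 = U * Q) : -5 * V.coeff 3 ^ 2 = U.coeff 2 * Q.coeff 4 := by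
  have h1 := congrArg (fun P => P.coeff 6) h
  have e1 : (U * Q).coeff 6 = U.coeff 2 * Q.coeff 4 := coeff_mul_add_eq_of_natDegree_le hU hQ
  have e2 : (V ^ 2).coeff 6 = V.coeff 3 ^ 2 := coeff_pow_of_natDegree_le (n := 3) (m := 2) hV
  have e3 : (C d ^ 2 * Fz).coeff 6 = 0 := by
    apply coeff_eq_zero_of_natDegree_lt
    have : (C d ^ 2 * Fz).natDegree ≤ 5 := by
      rw [Fz]; compute_degree
    omega
  have e4 : (5 * V ^ 2).coeff 6 = 5 * (V ^ 2).coeff 6 := coeff_ofNat_mul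
  simp only [coeff_sub] at h1
  rw [e1, e3, e4, e2] at h1
  linear_combination h1

section NF
variable {K : Type*} [Field K] [NumberField K]

theorem good_data {θ : 𝓞 K} (hθ : θ ^ 5 = 2) {U : ℤ[X]}
    (hU : U.natDegree ≤ 2) (hUp : ∀ l : ℕ, l.Prime → U.map (Int.castRingHom (ZMod l)) ≠ 0) (n : ℕ) :
    ∀ (d : ℤ) (V Q : ℤ[X]), d.natAbs = n → d ≠ 0 → V.natDegree ≤ 3 → Q.natDegree ≤ 4 →
    C d ^ 2 * Fz - 5 * V ^ 2 = U * Q →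
    ∃ (d : ℤ) (V Q : ℤ[X]), d ≠ 0 ∧ V.natDegree ≤ 3 ∧ Q.natDegree ≤ 4 ∧
      C d ^ 2 * Fz - 5 * V ^ 2 = U * Q ∧
      ∀ π : 𝓞 K, Prime π → π ∣ hat (θ ^ 2) 2 U → π ∣ hat (θ ^ 2) 4 Q → π ∣ θ ∨ π ∣ 1 + θ ^ 2 := by
  induction n using Nat.strong_induction_on with
  | _ n ih =>
  intro d V Q hdn hd hV hQ h
  by_cases hg : ∀ π : 𝓞 K, Prime π → π ∣ hat (θ ^ 2) 2 U → π ∣ hat (θ ^ 2) 4 Q → π ∣ θ ∨ π ∣ 1 + θ ^ 2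
  · exact ⟨d, V, Q, hd, hV, hQ, h, hg⟩
  push Not at hg
  obtain ⟨π, hπ, hπU, hπQ, hπθ, hπω⟩ := hg
  have hI : (Ideal.span {π}).IsPrime := (Ideal.span_singleton_prime hπ.ne_zero).2 hπ
  have hIb : Ideal.span {π} ≠ ⊥ := by simpa using hπ.ne_zero
  have hIm : (Ideal.span {π}).IsMaximal := hI.isMaximal hIb
  let _ : Field (𝓞 K ⧸ Ideal.span {π}) := Ideal.Quotient.field _
  have hfin : Finite (𝓞 K ⧸ Ideal.span {π}) := Ideal.finiteQuotientOfFreeOfNeBot _ hIb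
  set φ := Ideal.Quotient.mk (Ideal.span {π}) with hφ
  have h0 : ∀ x, φ x = 0 ↔ π ∣ x := fun x => by
    rw [hφ, Ideal.Quotient.eq_zero_iff_mem, Ideal.mem_span_singleton]
  have hη : φ (θ ^ 2) ≠ 0 := by
    rw [Ne, h0]; exact fun h => hπθ (hπ.dvd_of_dvd_pow h)
  have h2 : (2 : 𝓞 K ⧸ Ideal.span {π}) ≠ 0 := by
    intro h
    have : φ 2 = 0 := by rw [map_ofNat]; exact h
    rw [h0, ← hθ] at this
    exact hπθ (hπ.dvd_of_dvd_pow this)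
  have h5 : (5 : 𝓞 K ⧸ Ideal.span {π}) ≠ 0 := by
    intro h
    have : φ 5 = 0 := by rw [map_ofNat]; exact h
    rw [h0] at this
    exact hπω (dvd_omega_of_five hθ hπ this)
  have hη5 : φ (θ ^ 2) ^ 5 = 4 := by
    rw [← map_pow, ← pow_mul, mul_comm, pow_mul, hθ, map_pow, map_ofNat]; norm_num
  have hUξ := (h0 _).2 hπU
  have hQξ := (h0 _).2 hπQ
  rw [hat_map φ _ hη _ _ hU] at hUξ
  rw [hat_map φ _ hη _ _ hQ] at hQξ
  obtain ⟨d', V', Q', hd', hlt, hV', hQ', h'⟩ := descent _ (aeval_Fz _ hη hη5) (aeval_dFz _ hη h2 h5) h5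
    hd hU hV hQ hUp h (coeff_six hU hV hQ h) ((mul_eq_zero.1 hUξ).resolve_left (pow_ne_zero _ hη))
    ((mul_eq_zero.1 hQξ).resolve_left (pow_ne_zero _ hη))
  exact ih _ (hdn ▸ hlt) d' V' Q' rfl hd' hV' hQ' h'

theorem H1prim (hK : finrank ℚ K = 5) {θ : 𝓞 K} (hθ : θ ^ 5 = 2) {U V Q : ℤ[X]} {d : ℤ} (hd : d ≠ 0)
    (hU : U.natDegree ≤ 2) (hV : V.natDegree ≤ 3) (hQ : Q.natDegree ≤ 4)
    (hUp : ∀ l : ℕ, l.Prime → U.map (Int.castRingHom (ZMod l)) ≠ 0)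
    (h : C d ^ 2 * Fz - 5 * V ^ 2 = U * Q)
    (hS : (Odd (U.coeff 1) ∧ Even (U.coeff 0) ∧ 4 ∣ U.coeff 2) ∨
      (Odd (U.coeff 2) ∧ Even (U.coeff 1) ∧ Even (U.coeff 0))) :
    ∃ (κ : ℤ) (γ : K), κ ≠ 0 ∧ κ * aeval (-(1 + (θ : K) ^ 2) / (θ : K) ^ 2) U = γ ^ 2 := by
  obtain ⟨d, V, Q, hd, hV, hQ, h, hg⟩ := good_data hθ hU hUp _ d V Q rfl hd hV hQ h
  have hpθ := prime_theta hK hθ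
  have hθ0 : (θ : K) ≠ 0 := by
    intro h0; exact hpθ.ne_zero (by exact_mod_cast h0)
  have hinj : Function.Injective (algebraMap (𝓞 K) K) := RingOfIntegers.coe_injective
  have hη : algebraMap (𝓞 K) K (θ ^ 2) ≠ 0 := by rw [map_pow]; exact pow_ne_zero 2 hθ0
  have hη5 : (algebraMap (𝓞 K) K (θ ^ 2)) ^ 5 = 4 := by
    rw [← map_pow, ← pow_mul, mul_comm, pow_mul, hθ, map_pow, map_ofNat]; norm_num
  have hprod : hat (θ ^ 2) 2 U * hat (θ ^ 2) 4 Q = -5 * (hat (θ ^ 2) 3 V) ^ 2 := by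
    apply hinj
    have e := congrArg (aeval (-(1 + algebraMap (𝓞 K) K (θ ^ 2)) / algebraMap (𝓞 K) K (θ ^ 2))) h
    rw [map_sub, map_mul, aeval_Fz _ hη hη5, map_mul, map_mul, map_pow _ V, map_ofNat] at e
    rw [map_mul, map_mul, map_pow, hat_map _ _ hη _ _ hU, hat_map _ _ hη _ _ hQ, hat_map _ _ hη _ _ hV,
      map_neg, map_ofNat]
    linear_combination - (algebraMap (𝓞 K) K (θ ^ 2)) ^ 6 * e
  have hUhat : hat (θ ^ 2) 2 U = U.coeff 0 * θ ^ 4 - U.coeff 1 * (1 + θ ^ 2) * θ ^ 2 + U.coeff 2 * (1 + θ ^ 2) ^ 2 := by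
    rw [hat]; simp only [Finset.sum_range_succ, Finset.sum_range_zero]; ring
  have hUK := hat_map (algebraMap (𝓞 K) K) _ hη 2 U hU
  have hcoe : algebraMap (𝓞 K) K (θ ^ 2) = (θ : K) ^ 2 := map_pow _ _ _
  rw [hcoe] at hUK
  have hη2 : (θ : K) ^ 2 ≠ 0 := pow_ne_zero 2 hθ0
  rcases hS with ⟨⟨a, ha⟩, ⟨b, hb⟩, ⟨c, hc⟩⟩ | ⟨⟨a, ha⟩, ⟨b, hb⟩, ⟨c, hc⟩⟩
  · have hδ : hat (θ ^ 2) 2 U = θ ^ 2 * (U.coeff 0 * θ ^ 2 - U.coeff 1 * (1 + θ ^ 2) + c * θ ^ 8 * (1 + θ ^ 2) ^ 2) := by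
      rw [hUhat, hc]; push_cast
      linear_combination (- c * (1 + θ ^ 2) ^ 2 * (θ ^ 5 + 2)) * hθ
    set δ := (U.coeff 0 * θ ^ 2 - U.coeff 1 * (1 + θ ^ 2) + c * θ ^ 8 * (1 + θ ^ 2) ^ 2) with hδd
    have hsq : δ - (1 + θ) ^ 2 = θ ^ 4 * (b * θ ^ 3 - (a + 1) * θ * (1 + θ ^ 2) - θ ^ 2 + c * θ ^ 4 * (1 + θ ^ 2) ^ 2) := by
      rw [hδd, hb, ha]; push_cast
      linear_combination (-b * θ ^ 2 + (a + 1) * (1 + θ ^ 2) + θ) * hθ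
    obtain ⟨κ, γ, hκ, hγ⟩ := H1core hK hθ (δ := δ) (y := θ ^ 2 * hat (θ ^ 2) 4 Q) (z := hat (θ ^ 2) 3 V)
      (by
        apply not_dvd_of hK hθ
        have : δ - 1 = (δ - (1 + θ) ^ 2) + θ * (2 + θ) := by ring
        rw [this, hsq]
        exact dvd_add (((dvd_pow_self θ (by norm_num)).mul_right _)) (Dvd.intro _ rfl))
      (by rw [← hprod, hδ]; ring)
      (by
        intro π hπ h1 h2
        rcases hπ.dvd_or_dvd h2 with h3 | h3
        · exact Or.inl (hπ.dvd_of_dvd_pow h3)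
        · exact hg π hπ (by rw [hδ]; exact h1.mul_left _) h3)
      ⟨1 + θ, _, hsq⟩
    refine ⟨κ, γ / θ, hκ, ?_⟩
    have e := congrArg (algebraMap (𝓞 K) K) hγ
    rw [map_mul, map_intCast, map_pow] at e
    rw [hδ, map_mul, hcoe] at hUK
    have e2 : algebraMap (𝓞 K) K δ = (θ : K) ^ 2 * aeval (-(1 + (θ : K) ^ 2) / (θ : K) ^ 2) U := by
      apply mul_left_cancel₀ hη2
      rw [hUK]; ring
    rw [e2] at e
    rw [div_pow, ← e]
    field_simp
  · set δ := hat (θ ^ 2) 2 U with hδd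
    have hsq : δ - (1 + θ ^ 2) ^ 2 = θ ^ 4 * (c * θ ^ 5 - b * θ ^ 3 * (1 + θ ^ 2) + a * θ * (1 + θ ^ 2) ^ 2) := by
      rw [hUhat, hb, ha, hc]; push_cast
      linear_combination (-c * θ ^ 4 + b * θ ^ 2 * (1 + θ ^ 2) - a * (1 + θ ^ 2) ^ 2) * hθ
    obtain ⟨κ, γ, hκ, hγ⟩ := H1core hK hθ (δ := δ) (y := hat (θ ^ 2) 4 Q) (z := hat (θ ^ 2) 3 V)
      (by
        apply not_dvd_of hK hθ
        have : δ - 1 = (δ - (1 + θ ^ 2) ^ 2) + θ * (2 * θ + θ ^ 3) := by ring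
        rw [this, hsq]
        exact dvd_add (((dvd_pow_self θ (by norm_num)).mul_right _)) (Dvd.intro _ rfl))
      hprod hg ⟨1 + θ ^ 2, _, hsq⟩
    refine ⟨κ, γ / θ ^ 2, hκ, ?_⟩
    have e := congrArg (algebraMap (𝓞 K) K) hγ
    rw [map_mul, map_intCast, map_pow] at e
    rw [hUK] at e
    rw [div_pow, ← e]
    field_simp

theorem odd_four {c x : ℤ} (hc : Odd c) (h : 4 ∣ c * x) : 4 ∣ x := by
  have : IsCoprime (4 : ℤ) c := by
    obtain ⟨k, rfl⟩ := hc
    have : IsCoprime (2 : ℤ) (2 * k + 1) := ⟨-k, 1, by ring⟩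
    exact (this.pow_left (m := 2))
  exact this.dvd_of_dvd_mul_left h

theorem H1 (hK : finrank ℚ K = 5) {θ : 𝓞 K} (hθ : θ ^ 5 = 2) {U V Q : ℤ[X]} {d : ℤ} (hd : d ≠ 0)
    (hU : U.natDegree ≤ 2) (hV : V.natDegree ≤ 3) (hQ : Q.natDegree ≤ 4)
    (h : C d ^ 2 * Fz - 5 * V ^ 2 = U * Q)
    (hS : (Odd (U.coeff 1) ∧ Even (U.coeff 0) ∧ 4 ∣ U.coeff 2) ∨
      (Odd (U.coeff 2) ∧ Even (U.coeff 1) ∧ Even (U.coeff 0))) :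
    ∃ (κ : ℤ) (γ : K), κ ≠ 0 ∧ κ * aeval (-(1 + (θ : K) ^ 2) / (θ : K) ^ 2) U = γ ^ 2 := by
  have hU0 : U ≠ 0 := by rintro rfl; simp at hS
  have hcont : U = C U.content * U.primPart := U.eq_C_content_mul_primPart
  set c := U.content with hc
  set U' := U.primPart with hU'
  have hc0 : c ≠ 0 := by rw [hc, Ne, content_eq_zero_iff]; exact hU0
  have hco : ∀ i, U.coeff i = c * U'.coeff i := by
    intro i; conv_lhs => rw [hcont]
    rw [coeff_C_mul]
  have hS' : (Odd (U'.coeff 1) ∧ Even (U'.coeff 0) ∧ 4 ∣ U'.coeff 2) ∨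
      (Odd (U'.coeff 2) ∧ Even (U'.coeff 1) ∧ Even (U'.coeff 0)) := by
    rw [hco, hco, hco] at hS
    rcases hS with ⟨h1, h2, h3⟩ | ⟨h1, h2, h3⟩
    · obtain ⟨h4, h5⟩ := Int.odd_mul.1 h1
      have h6 := Int.not_even_iff_odd.2 h4
      exact Or.inl ⟨h5, (Int.even_mul.1 h2).resolve_left h6, odd_four h4 h3⟩
    · obtain ⟨h4, h5⟩ := Int.odd_mul.1 h1
      have h6 := Int.not_even_iff_odd.2 h4
      exact Or.inr ⟨h5, (Int.even_mul.1 h2).resolve_left h6, (Int.even_mul.1 h3).resolve_left h6⟩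
  have hprim : ∀ l : ℕ, l.Prime → U'.map (Int.castRingHom (ZMod l)) ≠ 0 := by
    intro l hl h0
    obtain ⟨P', hP', -⟩ := dvd_of_map_eq_zero h0
    have := U.isPrimitive_primPart (l : ℤ) ⟨P', hP'⟩
    rw [Int.isUnit_iff] at this
    have := hl.two_le
    omega
  obtain ⟨κ, γ, hκ, hγ⟩ := H1prim hK hθ (U := U') (V := V) (Q := C c * Q) hd
    (by rw [hU', natDegree_primPart]; exact hU) hV ((natDegree_C_mul_le _ _).trans hQ) hprim
    (by rw [h]; conv_lhs => rw [hcont]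
        ring) hS'
  refine ⟨κ * c, c * γ, mul_ne_zero hκ hc0, ?_⟩
  rw [hcont, map_mul, aeval_C, mul_pow, ← hγ]
  push_cast
  simp only [eq_intCast]
  ring
end NF
end RC

namespace RC
open Module NumberField

/-- coefficient equations for `d^2 (4 (1+x)^5+1) - 5 V^2 = U Q` -/
def EData (d v3 v2 v1 v0 u2 u1 u0 q4 q3 q2 q1 q0 : ℤ) : Prop :=
  -5 * v3 ^ 2 = u2 * q4 ∧
  4 * d ^ 2 - 10 * v3 * v2 = u2 * q3 + u1 * q4 ∧
  20 * d ^ 2 - 5 * (v2 ^ 2 + 2 * v3 * v1) = u2 * q2 + u1 * q3 + u0 * q4 ∧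
  40 * d ^ 2 - 10 * (v3 * v0 + v2 * v1) = u2 * q1 + u1 * q2 + u0 * q3 ∧
  40 * d ^ 2 - 5 * (v1 ^ 2 + 2 * v2 * v0) = u2 * q0 + u1 * q1 + u0 * q2 ∧
  20 * d ^ 2 - 10 * v1 * v0 = u1 * q0 + u0 * q1 ∧
  5 * d ^ 2 - 5 * v0 ^ 2 = u0 * q0

/-- coefficient equations for `5 U L^2 + 10 e V L - e^2 Q = k W^2` -/
def WData (v3 v2 v1 v0 u2 u1 u0 q4 q3 q2 q1 q0 l1 l0 e k w2 w1 w0 : ℤ) : Prop :=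
  5 * u2 * l1 ^ 2 + 10 * e * v3 * l1 - e ^ 2 * q4 = k * w2 ^ 2 ∧
  5 * (u1 * l1 ^ 2 + 2 * u2 * l1 * l0) + 10 * e * (v2 * l1 + v3 * l0) - e ^ 2 * q3 = 2 * k * w2 * w1 ∧
  5 * (u0 * l1 ^ 2 + 2 * u1 * l1 * l0 + u2 * l0 ^ 2) + 10 * e * (v1 * l1 + v2 * l0) - e ^ 2 * q2
    = k * (w1 ^ 2 + 2 * w2 * w0) ∧
  5 * (2 * u0 * l1 * l0 + u1 * l0 ^ 2) + 10 * e * (v0 * l1 + v1 * l0) - e ^ 2 * q1 = 2 * k * w1 * w0 ∧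
  5 * u0 * l0 ^ 2 + 10 * e * v0 * l0 - e ^ 2 * q0 = k * w0 ^ 2

section NF
variable {K : Type*} [Field K] [NumberField K]

theorem deg5 (hK : finrank ℚ K = 5) {θ : 𝓞 K} (hθ : θ ^ 5 = 2) (x0 : K)
    (hx0 : x0 = -(1 + (θ : K) ^ 2) / (θ : K) ^ 2) (c4 c3 c2 c1 c0 : ℤ)
    (h : c4 * x0 ^ 4 + c3 * x0 ^ 3 + c2 * x0 ^ 2 + c1 * x0 + c0 = 0) :
    c4 = 0 ∧ c3 = 0 ∧ c2 = 0 ∧ c1 = 0 ∧ c0 = 0 := by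
  have hpθ := prime_theta hK hθ
  have hθ0 : (θ : K) ≠ 0 := by
    intro h0; exact hpθ.ne_zero (by exact_mod_cast h0)
  have hInteg : IsIntegral ℚ x0 := Algebra.IsIntegral.isIntegral x0
  have hdeg : (minpoly ℚ x0).natDegree = 5 := by
    have h1 : (minpoly ℚ x0).natDegree ∣ 5 := hK ▸ minpoly.degree_dvd hInteg
    rcases (Nat.dvd_prime (by norm_num)).1 h1 with h2 | h2
    · exfalso
      rw [minpoly.natDegree_eq_one_iff] at h2
      obtain ⟨q, hq⟩ := h2
      have e1 : (1 + x0) * (θ : K) ^ 2 = -1 := by rw [hx0]; field_simp; ring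
      have e2 : (1 + x0) ^ 5 * 4 = -1 := by
        have e3 : ((θ : K) ^ 2) ^ 5 = 4 := by
          have : (θ : K) ^ 5 = 2 := by rw [← map_pow, hθ, map_ofNat]
          calc ((θ : K) ^ 2) ^ 5 = ((θ : K) ^ 5) ^ 2 := by ring
            _ = 4 := by rw [this]; norm_num
        rw [← e3, ← mul_pow, e1]; norm_num
      rw [← hq] at e2
      have e4 : (1 + q) ^ 5 * 4 = -1 := by
        apply (algebraMap ℚ K).injective
        push_cast [map_mul, map_add, map_pow, map_one, map_neg, map_ofNat]
        exact e2
      have hq1 : (1 + q) ≠ 0 := by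
        intro h0; rw [h0] at e4; norm_num at e4
      apply no5_pow 2 (by norm_num) (-(1 + q)⁻¹)
      have : (-(1 + q)⁻¹) ^ 5 = 4 := by
        rw [Odd.neg_pow (by decide : Odd 5), inv_pow]
        field_simp
        linear_combination -e4
      rw [this]; norm_num
    · exact h2
  set P : ℚ[X] := C (c4 : ℚ) * X ^ 4 + C (c3 : ℚ) * X ^ 3 + C (c2 : ℚ) * X ^ 2 + C (c1 : ℚ) * X + C (c0 : ℚ) with hP
  have hP0 : P = 0 := by
    apply eq_zero_of_dvd_of_natDegree_lt (p := minpoly ℚ x0)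
    · apply minpoly.dvd
      simp [hP]; exact h
    · rw [hdeg]
      have : P.natDegree ≤ 4 := by rw [hP]; compute_degree
      omega
  have hc : ∀ i, P.coeff i = 0 := by rw [hP0]; simp
  have a0 := hc 0
  have a1 := hc 1
  have a2 := hc 2
  have a3 := hc 3
  have a4 := hc 4
  simp only [hP, coeff_add, coeff_C_mul, coeff_X, coeff_C, coeff_X_pow] at a0 a1 a2 a3 a4
  norm_num at a0 a1 a2 a3 a4
  exact ⟨a4, a3, a2, a1, a0⟩

theorem H1' (hK : finrank ℚ K = 5) {θ : 𝓞 K} (hθ : θ ^ 5 = 2) (x0 : K)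
    (hx0 : x0 = -(1 + (θ : K) ^ 2) / (θ : K) ^ 2)
    {d v3 v2 v1 v0 u2 u1 u0 q4 q3 q2 q1 q0 : ℤ} (hd : d ≠ 0)
    (h : EData d v3 v2 v1 v0 u2 u1 u0 q4 q3 q2 q1 q0)
    (hS : (Odd u1 ∧ Even u0 ∧ 4 ∣ u2) ∨ (Odd u2 ∧ Even u1 ∧ Even u0)) :
    ∃ (κ : ℤ) (γ : K), κ ≠ 0 ∧ κ * (u2 * x0 ^ 2 + u1 * x0 + u0) = γ ^ 2 := by
  obtain ⟨h6, h5, h4, h3, h2, h1, h0⟩ := h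
  have hC5 : (C 5 : ℤ[X]) = 5 := rfl
  obtain ⟨κ, γ, hκ, hγ⟩ := H1 hK hθ (U := C u2 * X ^ 2 + C u1 * X + C u0)
    (V := C v3 * X ^ 3 + C v2 * X ^ 2 + C v1 * X + C v0)
    (Q := C q4 * X ^ 4 + C q3 * X ^ 3 + C q2 * X ^ 2 + C q1 * X + C q0) hd
    (by compute_degree) (by compute_degree) (by compute_degree) (by
      replace h6 := congrArg (C : ℤ → ℤ[X]) h6
      replace h5 := congrArg (C : ℤ → ℤ[X]) h5
      replace h4 := congrArg (C : ℤ → ℤ[X]) h4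
      replace h3 := congrArg (C : ℤ → ℤ[X]) h3
      replace h2 := congrArg (C : ℤ → ℤ[X]) h2
      replace h1 := congrArg (C : ℤ → ℤ[X]) h1
      replace h0 := congrArg (C : ℤ → ℤ[X]) h0
      simp only [map_add, map_sub, map_mul, map_pow, map_neg, map_ofNat] at h0 h1 h2 h3 h4 h5 h6
      rw [Fz]
      linear_combination X ^ 6 * h6 + X ^ 5 * h5 + X ^ 4 * h4 + X ^ 3 * h3 + X ^ 2 * h2 + X * h1 + h0)
    (by simp only [coeff_add, coeff_C_mul, coeff_X, coeff_C, coeff_X_pow]; norm_num; exact hS)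
  refine ⟨κ, γ, hκ, ?_⟩
  rw [← hγ, hx0]
  simp

theorem W_ne_zero {d v3 v2 v1 v0 u2 u1 u0 q4 q3 q2 q1 q0 l1 l0 e k : ℤ} (hd : d ≠ 0)
    (h : EData d v3 v2 v1 v0 u2 u1 u0 q4 q3 q2 q1 q0)
    (hU : ¬ (u2 = 0 ∧ u1 = 0 ∧ u0 = 0))
    (hW : WData v3 v2 v1 v0 u2 u1 u0 q4 q3 q2 q1 q0 l1 l0 e k 0 0 0) : l1 = 0 ∧ l0 = 0 ∧ e = 0 := by
  obtain ⟨h6, h5, h4, h3, h2, h1, h0⟩ := h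
  obtain ⟨g4, g3, g2, g1, g0⟩ := hW
  have a3 : e * v3 + u2 * l1 = 0 := by
    have : 5 * (e * v3 + u2 * l1) ^ 2 = 0 := by linear_combination u2 * g4 - e ^ 2 * h6
    simpa using this
  have he : e = 0 := by
    have : 4 * (e * d) ^ 2 = 0 := by
      linear_combination 10 * (e * v2 + u2 * l0 + u1 * l1) * a3 - u2 * g3 - u1 * g4 + e ^ 2 * h5
    have : e * d = 0 := by simpa using this
    exact (mul_eq_zero.1 this).resolve_right hd
  subst he
  have hl1 : l1 = 0 := by
    by_contra hl
    have hl2 : l1 ^ 2 ≠ 0 := pow_ne_zero 2 hl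
    have t2 : u2 = 0 := by
      have : u2 * l1 ^ 2 = 0 := by linarith
      exact (mul_eq_zero.1 this).resolve_right hl2
    subst t2
    have t1 : u1 = 0 := by
      have : u1 * l1 ^ 2 = 0 := by linarith
      exact (mul_eq_zero.1 this).resolve_right hl2
    subst t1
    have t0 : u0 = 0 := by
      have : u0 * l1 ^ 2 = 0 := by linarith
      exact (mul_eq_zero.1 this).resolve_right hl2
    exact hU ⟨rfl, rfl, t0⟩
  subst hl1
  refine ⟨rfl, ?_, rfl⟩
  by_contra hl
  have hl2 : l0 ^ 2 ≠ 0 := pow_ne_zero 2 hl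
  apply hU
  refine ⟨?_, ?_, ?_⟩
  · have : u2 * l0 ^ 2 = 0 := by linarith
    exact (mul_eq_zero.1 this).resolve_right hl2
  · have : u1 * l0 ^ 2 = 0 := by linarith
    exact (mul_eq_zero.1 this).resolve_right hl2
  · have : u0 * l0 ^ 2 = 0 := by linarith
    exact (mul_eq_zero.1 this).resolve_right hl2

theorem H2raw (hK : finrank ℚ K = 5) {θ : 𝓞 K} (hθ : θ ^ 5 = 2)
    {d v3 v2 v1 v0 u2 u1 u0 q4 q3 q2 q1 q0 : ℤ} (hd : d ≠ 0)
    (h : EData d v3 v2 v1 v0 u2 u1 u0 q4 q3 q2 q1 q0)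
    (hS : (Odd u1 ∧ Even u0 ∧ 4 ∣ u2) ∨ (Odd u2 ∧ Even u1 ∧ Even u0)) :
    ∃ l1 l0 e k w2 w1 w0 : ℤ, k ≠ 0 ∧ ¬ (l1 = 0 ∧ l0 = 0 ∧ e = 0) ∧ ¬ (w2 = 0 ∧ w1 = 0 ∧ w0 = 0) ∧
      WData v3 v2 v1 v0 u2 u1 u0 q4 q3 q2 q1 q0 l1 l0 e k w2 w1 w0 := by
  have hpθ := prime_theta hK hθ
  have hθ0 : (θ : K) ≠ 0 := by
    intro h0; exact hpθ.ne_zero (by exact_mod_cast h0)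
  obtain ⟨x0, hx0⟩ : ∃ x0 : K, x0 = -(1 + (θ : K) ^ 2) / (θ : K) ^ 2 := ⟨_, rfl⟩
  have hF : 4 * (1 + x0) ^ 5 + 1 = 0 := by
    have e1 : (1 + x0) * (θ : K) ^ 2 = -1 := by rw [hx0]; field_simp; ring
    have e3 : ((θ : K) ^ 2) ^ 5 = 4 := by
      have : (θ : K) ^ 5 = 2 := by rw [← map_pow, hθ, map_ofNat]
      calc ((θ : K) ^ 2) ^ 5 = ((θ : K) ^ 5) ^ 2 := by ring
        _ = 4 := by rw [this]; norm_num
    rw [← e3, mul_comm, ← mul_pow, e1]; norm_num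
  have hD := deg5 hK hθ x0 hx0
  obtain ⟨κ, γ, hκ, hγ⟩ := H1' hK hθ x0 hx0 hd h hS
  have hUne : ¬ (u2 = 0 ∧ u1 = 0 ∧ u0 = 0) := by
    rintro ⟨rfl, rfl, rfl⟩; simp at hS
  have hU0 : (u2 * x0 ^ 2 + u1 * x0 + u0 : K) ≠ 0 := by
    intro h0
    have := hD 0 0 u2 u1 u0 (by push_cast; linear_combination h0)
    exact hUne this.2.2
  -- the linear map
  set Vx : K := v3 * x0 ^ 3 + v2 * x0 ^ 2 + v1 * x0 + v0 with hVx
  set Ux : K := u2 * x0 ^ 2 + u1 * x0 + u0 with hUx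
  let f : (Fin 6 → ℚ) →ₗ[ℚ] K := Fintype.linearCombination ℚ ![Ux * x0, Ux, Vx, -γ * x0 ^ 2, -γ * x0, -γ]
  have hker : LinearMap.ker f ≠ ⊥ := LinearMap.ker_ne_bot_of_finrank_lt (by simp [hK])
  obtain ⟨v, hv, hv0⟩ := Submodule.exists_mem_ne_zero_of_ne_bot hker
  rw [LinearMap.mem_ker] at hv
  obtain ⟨b, hb⟩ := IsLocalization.exist_integer_multiples_of_finite (nonZeroDivisors ℤ) v
  choose w hw using hb
  have hb0 : ((b : ℤ) : ℚ) ≠ 0 := by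
    have := nonZeroDivisors.ne_zero b.2
    exact_mod_cast this
  have hw' : ∀ i, (w i : ℚ) = (b : ℤ) * v i := by
    intro i
    have := hw i
    simpa using this
  have hwK : ∀ i, (w i : K) = (b : ℤ) * (algebraMap ℚ K (v i)) := by
    intro i
    have := congrArg (algebraMap ℚ K) (hw' i)
    simpa using this
  have hrel : (w 2 : K) * Vx + Ux * (w 0 * x0 + w 1) = γ * (w 3 * x0 ^ 2 + w 4 * x0 + w 5) := by
    have e : f v = 0 := hv
    simp only [f, Fintype.linearCombination_apply, Fin.sum_univ_six] at e
    simp [Algebra.smul_def] at e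
    simp only [hwK, eq_ratCast]
    linear_combination (b : ℤ) * e
  have hwne : ∃ i, w i ≠ 0 := by
    by_contra hcon
    push Not at hcon
    apply hv0
    funext i
    have := hw' i
    rw [hcon i] at this
    simpa [hb0] using this.symm
  obtain ⟨l1, hl1⟩ : ∃ l1, l1 = w 0 := ⟨_, rfl⟩
  obtain ⟨l0, hl0⟩ : ∃ l1, l1 = w 1 := ⟨_, rfl⟩
  obtain ⟨e, he⟩ : ∃ l1, l1 = w 2 := ⟨_, rfl⟩
  obtain ⟨w2, hw2⟩ : ∃ l1, l1 = w 3 := ⟨_, rfl⟩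
  obtain ⟨w1, hw1⟩ : ∃ l1, l1 = w 4 := ⟨_, rfl⟩
  obtain ⟨w0, hw0⟩ : ∃ l1, l1 = w 5 := ⟨_, rfl⟩
  rw [← hl1, ← hl0, ← he, ← hw2, ← hw1, ← hw0] at hrel
  have hEK : (d : K) ^ 2 * (4 * (1 + x0) ^ 5 + 1) - 5 * Vx ^ 2 =
      Ux * (q4 * x0 ^ 4 + q3 * x0 ^ 3 + q2 * x0 ^ 2 + q1 * x0 + q0) := by
    obtain ⟨h6, h5, h4, h3, h2, h1, h0⟩ := h
    replace h6 := congrArg (Int.cast : ℤ → K) h6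
    replace h5 := congrArg (Int.cast : ℤ → K) h5
    replace h4 := congrArg (Int.cast : ℤ → K) h4
    replace h3 := congrArg (Int.cast : ℤ → K) h3
    replace h2 := congrArg (Int.cast : ℤ → K) h2
    replace h1 := congrArg (Int.cast : ℤ → K) h1
    replace h0 := congrArg (Int.cast : ℤ → K) h0
    push_cast at h0 h1 h2 h3 h4 h5 h6
    rw [hVx, hUx]
    linear_combination x0 ^ 6 * h6 + x0 ^ 5 * h5 + x0 ^ 4 * h4 + x0 ^ 3 * h3 + x0 ^ 2 * h2 + x0 * h1 + h0
  rw [hF] at hEK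
  have hmain : 5 * Ux * (l1 * x0 + l0) ^ 2 + 10 * e * Vx * (l1 * x0 + l0)
      - e ^ 2 * (q4 * x0 ^ 4 + q3 * x0 ^ 3 + q2 * x0 ^ 2 + q1 * x0 + q0)
      = 5 * κ * (w2 * x0 ^ 2 + w1 * x0 + w0) ^ 2 := by
    apply mul_left_cancel₀ hU0
    linear_combination (5 * (e * Vx + Ux * (l1 * x0 + l0)) + 5 * γ * (w2 * x0 ^ 2 + w1 * x0 + w0)) * hrel + e ^ 2 * hEK - 5 * (w2 * x0 ^ 2 + w1 * x0 + w0) ^ 2 * hγ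
  have hWD : WData v3 v2 v1 v0 u2 u1 u0 q4 q3 q2 q1 q0 l1 l0 e (5 * κ) w2 w1 w0 := by
    have := hD
      (5 * u2 * l1 ^ 2 + 10 * e * v3 * l1 - e ^ 2 * q4 - (5 * κ) * w2 ^ 2)
      (5 * (u1 * l1 ^ 2 + 2 * u2 * l1 * l0) + 10 * e * (v2 * l1 + v3 * l0) - e ^ 2 * q3 - 2 * (5 * κ) * w2 * w1)
      (5 * (u0 * l1 ^ 2 + 2 * u1 * l1 * l0 + u2 * l0 ^ 2) + 10 * e * (v1 * l1 + v2 * l0) - e ^ 2 * q2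
        - (5 * κ) * (w1 ^ 2 + 2 * w2 * w0))
      (5 * (2 * u0 * l1 * l0 + u1 * l0 ^ 2) + 10 * e * (v0 * l1 + v1 * l0) - e ^ 2 * q1 - 2 * (5 * κ) * w1 * w0)
      (5 * u0 * l0 ^ 2 + 10 * e * v0 * l0 - e ^ 2 * q0 - (5 * κ) * w0 ^ 2)
      (by push_cast; rw [hUx, hVx] at hmain; linear_combination hmain)
    obtain ⟨t4, t3, t2, t1, t0⟩ := this
    exact ⟨sub_eq_zero.1 t4, sub_eq_zero.1 t3, sub_eq_zero.1 t2, sub_eq_zero.1 t1, sub_eq_zero.1 t0⟩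
  have hall : ¬ ((l1 = 0 ∧ l0 = 0 ∧ e = 0) ∧ (w2 = 0 ∧ w1 = 0 ∧ w0 = 0)) := by
    rintro ⟨⟨a, b, c⟩, ⟨a', b', c'⟩⟩
    obtain ⟨i, hi⟩ := hwne
    apply hi
    fin_cases i
    · exact hl1 ▸ a
    · exact hl0 ▸ b
    · exact he ▸ c
    · exact hw2 ▸ a'
    · exact hw1 ▸ b'
    · exact hw0 ▸ c'
  have hκ5 : 5 * κ ≠ 0 := mul_ne_zero (by norm_num) hκ
  have i1 : (w2 = 0 ∧ w1 = 0 ∧ w0 = 0) → (l1 = 0 ∧ l0 = 0 ∧ e = 0) := by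
    rintro ⟨rfl, rfl, rfl⟩
    exact W_ne_zero hd h hUne hWD
  have i2 : (l1 = 0 ∧ l0 = 0 ∧ e = 0) → (w2 = 0 ∧ w1 = 0 ∧ w0 = 0) := by
    rintro ⟨rfl, rfl, rfl⟩
    obtain ⟨t4, t3, t2, t1, t0⟩ := hWD
    simp [hκ] at t4 t0
    subst t4; subst t0
    simp [hκ] at t2
    exact ⟨rfl, t2, rfl⟩
  exact ⟨l1, l0, e, 5 * κ, w2, w1, w0, hκ5, fun h => hall ⟨h, i2 h⟩, fun h => hall ⟨i1 h, h⟩, hWD⟩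
end NF

theorem prim2 (a b c : ℤ) (h : ¬ (a = 0 ∧ b = 0 ∧ c = 0)) : ∃ (j : ℕ) (a' b' c' : ℤ),
    a = 2 ^ j * a' ∧ b = 2 ^ j * b' ∧ c = 2 ^ j * c' ∧ ¬ (Even a' ∧ Even b' ∧ Even c') := by
  have key : ∀ (n : ℕ) (a b c : ℤ), a.natAbs + b.natAbs + c.natAbs = n → ¬ (a = 0 ∧ b = 0 ∧ c = 0) →
      ∃ (j : ℕ) (a' b' c' : ℤ),
    a = 2 ^ j * a' ∧ b = 2 ^ j * b' ∧ c = 2 ^ j * c' ∧ ¬ (Even a' ∧ Even b' ∧ Even c') := by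
    intro n
    induction n using Nat.strong_induction_on with
    | _ n ih =>
    intro a b c hn h
    by_cases he : Even a ∧ Even b ∧ Even c
    · obtain ⟨⟨a1, rfl⟩, ⟨b1, rfl⟩, ⟨c1, rfl⟩⟩ := he
      obtain ⟨j, a', b', c', rfl, rfl, rfl, h'⟩ := ih _ (by omega) a1 b1 c1 rfl (by omega)
      exact ⟨j + 1, a', b', c', by ring, by ring, by ring, h'⟩
    · exact ⟨0, a, b, c, by simp, by simp, by simp, he⟩
  exact key _ a b c rfl h
end RC

namespace RC
open Module NumberField

theorem exists_field0 : ∃ (K : Type) (_ : Field K) (_ : NumberField K) (θ : K),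
    finrank ℚ K = 5 ∧ θ ^ 5 = 2 := by
  have hirr : Irreducible (X ^ 5 - C 2 : ℚ[X]) := irr5 no5_two
  have : Fact (Irreducible (X ^ 5 - C 2 : ℚ[X])) := ⟨hirr⟩
  let K := AdjoinRoot (X ^ 5 - C 2 : ℚ[X])
  have hc : CharZero K := charZero_of_injective_algebraMap (algebraMap ℚ K).injective
  have hpb := AdjoinRoot.powerBasis hirr.ne_zero
  have hfin : FiniteDimensional ℚ K := (AdjoinRoot.powerBasis hirr.ne_zero).finite
  have hrank : finrank ℚ K = 5 := by
    rw [(AdjoinRoot.powerBasis hirr.ne_zero).finrank, AdjoinRoot.powerBasis_dim]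
    exact natDegree_X_pow_sub_C
  have hn : NumberField K := { to_charZero := hc, to_finiteDimensional := by convert hfin }
  have hr : (AdjoinRoot.root (X ^ 5 - C 2 : ℚ[X])) ^ 5 = (2 : K) := by
    have := AdjoinRoot.eval₂_root (X ^ 5 - C 2 : ℚ[X])
    simp at this
    exact sub_eq_zero.1 this
  exact ⟨K, inferInstance, hn, _, by convert hrank, hr⟩

theorem exists_field : ∃ (K : Type) (_ : Field K) (_ : NumberField K) (θ : 𝓞 K),
    finrank ℚ K = 5 ∧ θ ^ 5 = 2 := by
  obtain ⟨K, _, _, r, hK, hr⟩ := exists_field0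
  have hInteg : IsIntegral ℤ r := by
    refine ⟨X ^ 5 - C 2, monic_X_pow_sub_C 2 (by norm_num), ?_⟩
    simp
    exact sub_eq_zero.2 hr
  obtain ⟨θ, hθ⟩ : ∃ θ : 𝓞 K, algebraMap (𝓞 K) K θ = r := ⟨⟨r, hInteg⟩, rfl⟩
  refine ⟨K, inferInstance, inferInstance, θ, hK, ?_⟩
  apply RingOfIntegers.coe_injective
  rw [map_pow, map_ofNat, hθ]
  exact hr

theorem odd_pow_dvd {j : ℕ} {k x : ℤ} (hx : Odd x) (h : (2 ^ j : ℤ) ∣ k * x) : (2 ^ j : ℤ) ∣ k := by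
  have : IsCoprime ((2 : ℤ) ^ j) x := by
    obtain ⟨m, rfl⟩ := hx
    have : IsCoprime (2 : ℤ) (2 * m + 1) := ⟨-m, 1, by ring⟩
    exact this.pow_left
  exact this.dvd_of_dvd_mul_right h

theorem four_pow_dvd_of {j : ℕ} {k w2 w1 w0 : ℤ} (hw : ¬ (Even w2 ∧ Even w1 ∧ Even w0))
    (h2 : (2 ^ j : ℤ) ∣ k * w2 ^ 2) (h1 : (2 ^ j : ℤ) ∣ k * (w1 ^ 2 + 2 * w2 * w0))
    (h0 : (2 ^ j : ℤ) ∣ k * w0 ^ 2) : (2 ^ j : ℤ) ∣ k := by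
  rcases Int.even_or_odd w2 with e2 | e2
  · rcases Int.even_or_odd w0 with e0 | e0
    · rcases Int.even_or_odd w1 with e1 | e1
      · exact absurd ⟨e2, e1, e0⟩ hw
      · refine odd_pow_dvd ?_ h1
        have : Even (2 * w2 * w0) := ⟨w2 * w0, by ring⟩
        exact (e1.pow).add_even this
    · exact odd_pow_dvd e0.pow h0
  · exact odd_pow_dvd e2.pow h2

theorem H2 {d v3 v2 v1 v0 u2 u1 u0 q4 q3 q2 q1 q0 : ℤ} (hd : d ≠ 0)
    (h : EData d v3 v2 v1 v0 u2 u1 u0 q4 q3 q2 q1 q0)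
    (hS : (Odd u1 ∧ Even u0 ∧ 4 ∣ u2) ∨ (Odd u2 ∧ Even u1 ∧ Even u0)) :
    ∃ l1 l0 e k w2 w1 w0 : ℤ, k ≠ 0 ∧ ¬ (Even l1 ∧ Even l0 ∧ Even e) ∧ ¬ (Even w2 ∧ Even w1 ∧ Even w0) ∧
      WData v3 v2 v1 v0 u2 u1 u0 q4 q3 q2 q1 q0 l1 l0 e k w2 w1 w0 := by
  obtain ⟨K, _, _, θ, hK, hθ⟩ := exists_field
  obtain ⟨l1, l0, e, k, w2, w1, w0, hk, hl, hw, hW⟩ := H2raw hK hθ hd h hS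
  obtain ⟨i, l1, l0, e, rfl, rfl, rfl, hl'⟩ := prim2 _ _ _ hl
  obtain ⟨j, w2, w1, w0, rfl, rfl, rfl, hw'⟩ := prim2 _ _ _ hw
  obtain ⟨t4, t3, t2, t1, t0⟩ := hW
  have hI : (2 : ℤ) ^ (2 * i) ≠ 0 := by positivity
  have hp : ∀ m : ℕ, ((2 : ℤ) ^ m) ^ 2 = 2 ^ (2 * m) := fun m => by rw [← pow_mul, mul_comm]
  have hdvd : (2 : ℤ) ^ (2 * i) ∣ k * 2 ^ (2 * j) := by
    apply four_pow_dvd_of hw'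
    · refine ⟨5 * u2 * l1 ^ 2 + 10 * e * v3 * l1 - e ^ 2 * q4, ?_⟩
      rw [← hp, ← hp]; linear_combination -t4
    · refine ⟨5 * (u0 * l1 ^ 2 + 2 * u1 * l1 * l0 + u2 * l0 ^ 2) + 10 * e * (v1 * l1 + v2 * l0) - e ^ 2 * q2, ?_⟩
      rw [← hp, ← hp]; linear_combination -t2
    · refine ⟨5 * u0 * l0 ^ 2 + 10 * e * v0 * l0 - e ^ 2 * q0, ?_⟩
      rw [← hp, ← hp]; linear_combination -t0
  obtain ⟨k', hk'⟩ := hdvd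
  refine ⟨l1, l0, e, k', w2, w1, w0, ?_, hl', hw', ?_, ?_, ?_, ?_, ?_⟩
  · rintro rfl
    have : (2 : ℤ) ^ (2 * j) ≠ 0 := by positivity
    simp [hk] at hk'
  · apply mul_left_cancel₀ hI
    rw [← hp, ← hp] at hk'
    rw [← hp]; linear_combination t4 + w2 ^ 2 * hk'
  · apply mul_left_cancel₀ hI
    rw [← hp, ← hp] at hk'
    rw [← hp]; linear_combination t3 + 2 * w2 * w1 * hk'
  · apply mul_left_cancel₀ hI
    rw [← hp, ← hp] at hk'
    rw [← hp]; linear_combination t2 + (w1 ^ 2 + 2 * w2 * w0) * hk'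
  · apply mul_left_cancel₀ hI
    rw [← hp, ← hp] at hk'
    rw [← hp]; linear_combination t1 + 2 * w1 * w0 * hk'
  · apply mul_left_cancel₀ hI
    rw [← hp, ← hp] at hk'
    rw [← hp]; linear_combination t0 + w0 ^ 2 * hk'
end RC

namespace RC

/-- coefficient equations for `d^2 x^5 - 5 B (B + d (2x^2+2x+1)) = U Q` -/
def BData (d b3 b2 b1 b0 u2 u1 u0 q4 q3 q2 q1 q0 : ℤ) : Prop :=
  -5 * b3 ^ 2 = u2 * q4 ∧
  d ^ 2 - 5 * (2 * b3 * b2 + 2 * d * b3) = u2 * q3 + u1 * q4 ∧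
  -5 * (b2 ^ 2 + 2 * b3 * b1 + d * (2 * b2 + 2 * b3)) = u2 * q2 + u1 * q3 + u0 * q4 ∧
  -5 * (2 * b3 * b0 + 2 * b2 * b1 + d * (2 * b1 + 2 * b2 + b3)) = u2 * q1 + u1 * q2 + u0 * q3 ∧
  -5 * (b1 ^ 2 + 2 * b2 * b0 + d * (2 * b0 + 2 * b1 + b2)) = u2 * q0 + u1 * q1 + u0 * q2 ∧
  -5 * (2 * b1 * b0 + d * (2 * b0 + b1)) = u1 * q0 + u0 * q1 ∧
  -5 * (b0 ^ 2 + d * b0) = u0 * q0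

/-- first type of quadratic forms -/
def S1 (u2 u1 u0 : ℤ) : Prop := Odd u1 ∧ Even u0 ∧ 4 ∣ u2 ∧
  ∃ d v3 v2 v1 v0 q4 q3 q2 q1 q0 : ℤ, d ≠ 0 ∧ EData d v3 v2 v1 v0 u2 u1 u0 q4 q3 q2 q1 q0

/-- second type of quadratic forms -/
def S2 (u2 u1 u0 : ℤ) : Prop := Odd u2 ∧ Even u1 ∧ Even u0 ∧
  ∃ d b3 b2 b1 b0 q4 q3 q2 q1 q0 : ℤ, Odd d ∧ BData d b3 b2 b1 b0 u2 u1 u0 q4 q3 q2 q1 q0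

theorem EData_of_BData {d b3 b2 b1 b0 u2 u1 u0 q4 q3 q2 q1 q0 : ℤ}
    (h : BData d b3 b2 b1 b0 u2 u1 u0 q4 q3 q2 q1 q0) :
    EData d (2 * b3) (2 * d + 2 * b2) (2 * d + 2 * b1) (d + 2 * b0) u2 u1 u0
      (4 * q4) (4 * q3) (4 * q2) (4 * q1) (4 * q0) := by
  obtain ⟨h6, h5, h4, h3, h2, h1, h0⟩ := h
  refine ⟨?_, ?_, ?_, ?_, ?_, ?_, ?_⟩
  · linear_combination 4 * h6
  · linear_combination 4 * h5
  · linear_combination 4 * h4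
  · linear_combination 4 * h3
  · linear_combination 4 * h2
  · linear_combination 4 * h1
  · linear_combination 4 * h0

theorem EData_comp {d v3 v2 v1 v0 u2 u1 u0 q4 q3 q2 q1 q0 l1 l0 e k w2 w1 w0 : ℤ}
    (h : EData d v3 v2 v1 v0 u2 u1 u0 q4 q3 q2 q1 q0)
    (hW : WData v3 v2 v1 v0 u2 u1 u0 q4 q3 q2 q1 q0 l1 l0 e k w2 w1 w0) :
    EData (e * d) (e * v3 + u2 * l1) (e * v2 + u1 * l1 + u2 * l0) (e * v1 + u0 * l1 + u1 * l0)
      (e * v0 + u0 * l0) u2 u1 u0 (-k * w2 ^ 2) (-k * (2 * w2 * w1)) (-k * (w1 ^ 2 + 2 * w2 * w0))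
      (-k * (2 * w1 * w0)) (-k * w0 ^ 2) := by
  obtain ⟨h6, h5, h4, h3, h2, h1, h0⟩ := h
  obtain ⟨g4, g3, g2, g1, g0⟩ := hW
  refine ⟨?_, ?_, ?_, ?_, ?_, ?_, ?_⟩
  · linear_combination e ^ 2 * h6 - u2 * g4
  · linear_combination e ^ 2 * h5 - u2 * g3 - u1 * g4
  · linear_combination e ^ 2 * h4 - u2 * g2 - u1 * g3 - u0 * g4
  · linear_combination e ^ 2 * h3 - u2 * g1 - u1 * g2 - u0 * g3
  · linear_combination e ^ 2 * h2 - u2 * g0 - u1 * g1 - u0 * g2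
  · linear_combination e ^ 2 * h1 - u1 * g0 - u0 * g1
  · linear_combination e ^ 2 * h0 - u0 * g0

theorem EData_swap {d v3 v2 v1 v0 u2 u1 u0 k w2 w1 w0 : ℤ}
    (h : EData d v3 v2 v1 v0 u2 u1 u0 (-k * w2 ^ 2) (-k * (2 * w2 * w1)) (-k * (w1 ^ 2 + 2 * w2 * w0))
      (-k * (2 * w1 * w0)) (-k * w0 ^ 2)) :
    EData d v3 v2 v1 v0 w2 w1 w0 (-k * (u2 * w2)) (-k * (u2 * w1 + u1 * w2))
      (-k * (u2 * w0 + u1 * w1 + u0 * w2)) (-k * (u1 * w0 + u0 * w1)) (-k * (u0 * w0)) := by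
  obtain ⟨h6, h5, h4, h3, h2, h1, h0⟩ := h
  refine ⟨?_, ?_, ?_, ?_, ?_, ?_, ?_⟩
  · linear_combination h6
  · linear_combination h5
  · linear_combination h4
  · linear_combination h3
  · linear_combination h2
  · linear_combination h1
  · linear_combination h0

theorem BData_swap {d v3 v2 v1 v0 u2 u1 u0 k w2 w1 w0 : ℤ}
    (h : BData d v3 v2 v1 v0 u2 u1 u0 (-k * w2 ^ 2) (-k * (2 * w2 * w1)) (-k * (w1 ^ 2 + 2 * w2 * w0))
      (-k * (2 * w1 * w0)) (-k * w0 ^ 2)) :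
    BData d v3 v2 v1 v0 w2 w1 w0 (-k * (u2 * w2)) (-k * (u2 * w1 + u1 * w2))
      (-k * (u2 * w0 + u1 * w1 + u0 * w2)) (-k * (u1 * w0 + u0 * w1)) (-k * (u0 * w0)) := by
  obtain ⟨h6, h5, h4, h3, h2, h1, h0⟩ := h
  refine ⟨?_, ?_, ?_, ?_, ?_, ?_, ?_⟩
  · linear_combination h6
  · linear_combination h5
  · linear_combination h4
  · linear_combination h3
  · linear_combination h2
  · linear_combination h1
  · linear_combination h0

theorem BData_flip {d b3 b2 b1 b0 u2 u1 u0 q4 q3 q2 q1 q0 : ℤ}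
    (h : BData d b3 b2 b1 b0 u2 u1 u0 q4 q3 q2 q1 q0) :
    BData (-d) b3 (b2 + 2 * d) (b1 + 2 * d) (b0 + d) u2 u1 u0 q4 q3 q2 q1 q0 := by
  obtain ⟨h6, h5, h4, h3, h2, h1, h0⟩ := h
  refine ⟨?_, ?_, ?_, ?_, ?_, ?_, ?_⟩
  · linear_combination h6
  · linear_combination h5
  · linear_combination h4
  · linear_combination h3
  · linear_combination h2
  · linear_combination h1
  · linear_combination h0

theorem prim5 (x a b c d : ℤ) (h : ¬ (x = 0 ∧ a = 0 ∧ b = 0 ∧ c = 0 ∧ d = 0)) :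
    ∃ (j : ℕ) (x' a' b' c' d' : ℤ), x = 2 ^ j * x' ∧ a = 2 ^ j * a' ∧ b = 2 ^ j * b' ∧ c = 2 ^ j * c' ∧
      d = 2 ^ j * d' ∧ ¬ (Even x' ∧ Even a' ∧ Even b' ∧ Even c' ∧ Even d') := by
  have key : ∀ (n : ℕ) (x a b c d : ℤ), x.natAbs + a.natAbs + b.natAbs + c.natAbs + d.natAbs = n →
      ¬ (x = 0 ∧ a = 0 ∧ b = 0 ∧ c = 0 ∧ d = 0) →
      ∃ (j : ℕ) (x' a' b' c' d' : ℤ), x = 2 ^ j * x' ∧ a = 2 ^ j * a' ∧ b = 2 ^ j * b' ∧ c = 2 ^ j * c' ∧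
      d = 2 ^ j * d' ∧ ¬ (Even x' ∧ Even a' ∧ Even b' ∧ Even c' ∧ Even d') := by
    intro n
    induction n using Nat.strong_induction_on with
    | _ n ih =>
    intro x a b c d hn h
    by_cases he : Even x ∧ Even a ∧ Even b ∧ Even c ∧ Even d
    · obtain ⟨⟨x1, rfl⟩, ⟨a1, rfl⟩, ⟨b1, rfl⟩, ⟨c1, rfl⟩, ⟨d1, rfl⟩⟩ := he
      obtain ⟨j, x', a', b', c', d', rfl, rfl, rfl, rfl, rfl, h'⟩ := ih _ (by omega) x1 a1 b1 c1 d1 rfl (by omega)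
      exact ⟨j + 1, x', a', b', c', d', by ring, by ring, by ring, by ring, by ring, h'⟩
    · exact ⟨0, x, a, b, c, d, by simp, by simp, by simp, by simp, by simp, he⟩
  exact key _ x a b c d rfl h

/-- the coefficients of `U W^2` are not all even -/
theorem dvd_of_UW {j : ℕ} {k u2 u1 u0 w2 w1 w0 : ℤ} (hu1 : Odd u1) (hu0 : Even u0)
    (hw : ¬ (Even w2 ∧ Even w1 ∧ Even w0))
    (h5 : (2 ^ j : ℤ) ∣ k * (u2 * (2 * w2 * w1) + u1 * w2 ^ 2))
    (h3 : (2 ^ j : ℤ) ∣ k * (u2 * (2 * w1 * w0) + u1 * (w1 ^ 2 + 2 * w2 * w0) + u0 * (2 * w2 * w1)))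
    (h1 : (2 ^ j : ℤ) ∣ k * (u1 * w0 ^ 2 + u0 * (2 * w1 * w0))) : (2 ^ j : ℤ) ∣ k := by
  rcases Int.even_or_odd w2 with e2 | e2
  · rcases Int.even_or_odd w0 with e0 | e0
    · rcases Int.even_or_odd w1 with e1 | e1
      · exact absurd ⟨e2, e1, e0⟩ hw
      · refine odd_pow_dvd ?_ h3
        rw [← Int.not_even_iff_odd] at *
        simp [parity_simps, hu1, hu0, e1]
    · refine odd_pow_dvd ?_ h1
      rw [← Int.not_even_iff_odd] at *
      simp [parity_simps, hu1, hu0, e0]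
  · refine odd_pow_dvd ?_ h5
    rw [← Int.not_even_iff_odd] at *
    simp [parity_simps, hu1, e2]

theorem stepI_norm {u2 u1 u0 : ℤ} (h : S1 u2 u1 u0) : ∃ E a3 a2 a1 a0 k w2 w1 w0 : ℤ,
    ¬ (Even w2 ∧ Even w1 ∧ Even w0) ∧ ¬ (Even E ∧ Even a3 ∧ Even a2 ∧ Even a1 ∧ Even a0) ∧
    EData E a3 a2 a1 a0 u2 u1 u0 (-k * w2 ^ 2) (-k * (2 * w2 * w1)) (-k * (w1 ^ 2 + 2 * w2 * w0))
      (-k * (2 * w1 * w0)) (-k * w0 ^ 2) := by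
  obtain ⟨hu1, hu0, hu2, d, v3, v2, v1, v0, q4, q3, q2, q1, q0, hd, hE⟩ := h
  obtain ⟨l1, l0, e, k, w2, w1, w0, hk, -, hw, hW⟩ := H2 hd hE (Or.inl ⟨hu1, hu0, hu2⟩)
  have hA := EData_comp hE hW
  generalize e * d = E at hA
  generalize (e * v3 + u2 * l1) = a3 at hA
  generalize (e * v2 + u1 * l1 + u2 * l0) = a2 at hA
  generalize (e * v1 + u0 * l1 + u1 * l0) = a1 at hA
  generalize (e * v0 + u0 * l0) = a0 at hA
  have hne : ¬ (E = 0 ∧ a3 = 0 ∧ a2 = 0 ∧ a1 = 0 ∧ a0 = 0) := by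
    rintro ⟨rfl, rfl, rfl, rfl, rfl⟩
    obtain ⟨h6, h5, h4, h3, h2, h1, h0⟩ := hA
    obtain ⟨n, hn⟩ : ∃ n : ℕ, ¬ (2 ^ n : ℤ) ∣ k := by
      refine ⟨k.natAbs, fun hdv => ?_⟩
      have := Int.natAbs_dvd_natAbs.2 hdv
      rw [Int.natAbs_pow] at this
      have h3 := Nat.le_of_dvd (Int.natAbs_pos.2 hk) this
      have h4 : k.natAbs < 2 ^ k.natAbs := Nat.lt_two_pow_self
      simp at h3; omega
    apply hn
    apply dvd_of_UW (u2 := u2) hu1 hu0 hw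
    · exact ⟨0, by linear_combination h5⟩
    · exact ⟨0, by linear_combination h3⟩
    · exact ⟨0, by linear_combination h1⟩
  obtain ⟨j, E, a3, a2, a1, a0, rfl, rfl, rfl, rfl, rfl, hne'⟩ := prim5 _ _ _ _ _ hne
  obtain ⟨h6, h5, h4, h3, h2, h1, h0⟩ := hA
  have hp : (2 : ℤ) ^ (2 * j) = ((2 : ℤ) ^ j) ^ 2 := by rw [← pow_mul, mul_comm]
  obtain ⟨k', hk'⟩ : (2 : ℤ) ^ (2 * j) ∣ k := by
    apply dvd_of_UW (u2 := u2) hu1 hu0 hw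
    · exact ⟨- (4 * E ^ 2 - 10 * a3 * a2), by rw [hp]; linear_combination h5⟩
    · exact ⟨- (40 * E ^ 2 - 10 * (a3 * a0 + a2 * a1)), by rw [hp]; linear_combination h3⟩
    · exact ⟨- (20 * E ^ 2 - 10 * a1 * a0), by rw [hp]; linear_combination h1⟩
  rw [hp] at hk'
  have hI : ((2 : ℤ) ^ j) ^ 2 ≠ 0 := by positivity
  subst hk'
  refine ⟨E, a3, a2, a1, a0, k', w2, w1, w0, hw, hne', ?_, ?_, ?_, ?_, ?_, ?_, ?_⟩ <;>
    apply mul_left_cancel₀ hI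
  · linear_combination h6
  · linear_combination h5
  · linear_combination h4
  · linear_combination h3
  · linear_combination h2
  · linear_combination h1
  · linear_combination h0

end RC

namespace RC

theorem levelI {m : ℕ} (hm : 1 ≤ m) {E b3 b2 b1 b0 u2 u1 u0 k w2 w1 w0 : ℤ} (hE : Odd E) (hk : Odd k)
    (hw2 : Odd w2) (hb0 : Even b0)
    (h : BData E b3 b2 b1 b0 u2 u1 u0 (-k * w2 ^ 2) (-k * (2 * w2 * w1)) (-k * (w1 ^ 2 + 2 * w2 * w0))
      (-k * (2 * w1 * w0)) (-k * w0 ^ 2)) (h1 : (2 ^ m : ℤ) ∣ w1) (h0 : (2 ^ m : ℤ) ∣ w0) :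
    (2 ^ (m + 1) : ℤ) ∣ u0 ∧ (4 ^ (m + 1) : ℤ) ∣ u2 := by
  obtain ⟨g6, g5, g4, g3, g2, g1, g0⟩ := h
  obtain ⟨n, rfl⟩ : ∃ n, m = n + 1 := ⟨m - 1, by omega⟩
  obtain ⟨y1, hy1⟩ := h1
  obtain ⟨y0, hy0⟩ := h0
  have h5o : Odd (5 : ℤ) := ⟨2, by norm_num⟩
  set N : ℤ := 2 ^ n with hN
  have hP : (2 : ℤ) ^ (n + 1) = 2 * N := by rw [hN]; ring
  have hM : (2 : ℤ) ^ (n + 1 + 1) = 4 * N := by rw [hN]; ring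
  rw [hP] at hy1 hy0
  subst hy1 hy0
  obtain ⟨c0, hc0⟩ : (2 ^ (n + 1 + 1) : ℤ) ∣ b0 := by
    have : Odd (5 * (b0 + E)) := h5o.mul (hb0.add_odd hE)
    refine odd_pow_dvd this ?_
    rw [hM]
    exact ⟨u0 * k * N * y0 ^ 2, by linear_combination -g0⟩
  rw [hM] at hc0; subst hc0
  obtain ⟨c1, hc1⟩ : (2 ^ (n + 1 + 1) : ℤ) ∣ b1 := by
    refine odd_pow_dvd (h5o.mul hE) ?_
    rw [hM]
    exact ⟨u1 * k * N * y0 ^ 2 + u0 * k * 2 * y1 * N * y0 - 10 * b1 * c0 - 10 * E * c0, by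
      linear_combination -g1⟩
  rw [hM] at hc1; subst hc1
  obtain ⟨c2, hc2⟩ : (2 ^ (n + 1 + 1) : ℤ) ∣ b2 := by
    refine odd_pow_dvd (h5o.mul hE) ?_
    rw [hM]
    exact ⟨u2 * k * N * y0 ^ 2 + u1 * k * 2 * y1 * N * y0 + u0 * k * (N * y1 ^ 2 + w2 * y0)
      - 20 * N * c1 ^ 2 - 10 * b2 * c0 - 10 * E * c0 - 10 * E * c1, by
      linear_combination -g2⟩
  rw [hM] at hc2; subst hc2
  obtain ⟨c3, hc3⟩ : (2 ^ (n + 1 + 1) : ℤ) ∣ b3 := by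
    refine odd_pow_dvd (h5o.mul hE) ?_
    rw [hM]
    exact ⟨u2 * k * 2 * y1 * N * y0 + u1 * k * (N * y1 ^ 2 + w2 * y0) + u0 * k * w2 * y1
      - 10 * b3 * c0 - 40 * N * c1 * c2 - 10 * E * c2 - 10 * E * c1, by
      linear_combination -g3⟩
  rw [hM] at hc3; subst hc3
  have hkw : Odd (k * w2 ^ 2) := hk.mul hw2.pow
  constructor
  · refine odd_pow_dvd hkw ?_
    rw [hM]
    exact ⟨5 * (4 * N * c2 ^ 2 + 8 * N * c3 * c1 + E * (2 * c2 + 2 * c3))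
      - u2 * k * (N * y1 ^ 2 + w2 * y0) - u1 * k * w2 * y1, by linear_combination g4⟩
  · have h4 : (4 : ℤ) ^ (n + 1 + 1) = 2 ^ (2 * (n + 1 + 1)) := by rw [pow_mul]; norm_num
    rw [h4]
    refine odd_pow_dvd hkw ?_
    rw [mul_comm 2 (n + 1 + 1), pow_mul, hM]
    exact ⟨5 * c3 ^ 2, by linear_combination g6⟩

theorem stepI {u2 u1 u0 : ℤ} (h : S1 u2 u1 u0) : ∃ w2 w1 w0, S2 w2 w1 w0 ∧
    ∀ m : ℕ, 1 ≤ m → (2 ^ m : ℤ) ∣ w1 → (2 ^ m : ℤ) ∣ w0 → (2 ^ (m + 1) : ℤ) ∣ u0 ∧ (4 ^ (m + 1) : ℤ) ∣ u2 := by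
  obtain ⟨E, a3, a2, a1, a0, k, w2, w1, w0, hw, hne, hD⟩ := stepI_norm h
  obtain ⟨hu1, hu0, hu2, -⟩ := h
  have hu2e : Even u2 := even_iff_two_dvd.2 (dvd_trans (by norm_num) hu2)
  have key : ∃ E b3 b2 b1 b0 k : ℤ, Odd E ∧
      BData E b3 b2 b1 b0 u2 u1 u0 (-k * w2 ^ 2) (-k * (2 * w2 * w1)) (-k * (w1 ^ 2 + 2 * w2 * w0))
      (-k * (2 * w1 * w0)) (-k * w0 ^ 2) := by
    obtain ⟨h6, h5, h4, h3, h2, h1, h0⟩ := hD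
    have e3 : Even a3 := by
      have := congrArg (fun z : ℤ => Even z) h6
      simpa [parity_simps, hu2e, Int.even_pow, show ¬ Even (5 : ℤ) by decide] using this
    have e2 : Even a2 := by
      have := congrArg (fun z : ℤ => Even z) h4
      simpa [parity_simps, hu2e, hu0, Int.even_pow, show ¬ Even (5 : ℤ) by decide, show Even (20 : ℤ) by decide] using this
    have e1 : Even a1 := by
      have := congrArg (fun z : ℤ => Even z) h2
      simpa [parity_simps, hu2e, hu0, Int.even_pow, show ¬ Even (5 : ℤ) by decide, show Even (40 : ℤ) by decide] using this
    have e0 : Even E ↔ Even a0 := by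
      have := congrArg (fun z : ℤ => Even z) h0
      simpa [parity_simps, hu2e, hu0, Int.even_pow, show ¬ Even (5 : ℤ) by decide] using this
    have hEo : Odd E := by
      rw [← Int.not_even_iff_odd]
      intro hEe
      exact hne ⟨hEe, e3, e2, e1, e0.1 hEe⟩
    have e0' : Even (a0 - E) := by simp [parity_simps, e0]
    obtain ⟨b3, rfl⟩ := even_iff_two_dvd.1 e3
    obtain ⟨b2, hb2⟩ := even_iff_two_dvd.1 (e2.sub (even_two_mul E))
    obtain ⟨b1, hb1⟩ := even_iff_two_dvd.1 (e1.sub (even_two_mul E))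
    obtain ⟨b0, hb0⟩ := even_iff_two_dvd.1 e0'
    obtain rfl : a2 = 2 * E + 2 * b2 := by linarith
    obtain rfl : a1 = 2 * E + 2 * b1 := by linarith
    obtain rfl : a0 = E + 2 * b0 := by linarith
    obtain ⟨k', rfl⟩ : (2 ^ 2 : ℤ) ∣ k := by
      apply dvd_of_UW (u2 := u2) hu1 hu0 hw
      · exact ⟨- (E ^ 2 - 10 * b3 * (E + b2)), by linear_combination h5⟩
      · exact ⟨- (10 * E ^ 2 - 5 * (b3 * (E + 2 * b0)) - 10 * (E + b2) * (E + b1)), by linear_combination h3⟩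
      · exact ⟨- (5 * E ^ 2 - 5 * (E + b1) * (E + 2 * b0)), by linear_combination h1⟩
    refine ⟨E, b3, b2, b1, b0, k', hEo, ?_, ?_, ?_, ?_, ?_, ?_, ?_⟩ <;>
      apply mul_left_cancel₀ (show (4 : ℤ) ≠ 0 by norm_num)
    · linear_combination h6
    · linear_combination h5
    · linear_combination h4
    · linear_combination h3
    · linear_combination h2
    · linear_combination h1
    · linear_combination h0
  have key2 : ∃ E b3 b2 b1 b0 k : ℤ, Odd E ∧ Even b0 ∧
      BData E b3 b2 b1 b0 u2 u1 u0 (-k * w2 ^ 2) (-k * (2 * w2 * w1)) (-k * (w1 ^ 2 + 2 * w2 * w0))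
      (-k * (2 * w1 * w0)) (-k * w0 ^ 2) := by
    obtain ⟨E, b3, b2, b1, b0, k, hE, hB⟩ := key
    rcases Int.even_or_odd b0 with hb | hb
    · exact ⟨E, b3, b2, b1, b0, k, hE, hb, hB⟩
    · exact ⟨-E, _, _, _, _, k, hE.neg, hb.add_odd hE, BData_flip hB⟩
  obtain ⟨E, b3, b2, b1, b0, k, hE, hb0, hB⟩ := key2
  have hB' := hB
  obtain ⟨h6, h5, h4, h3, h2, h1, h0⟩ := hB'
  have hEn : ¬ Even E := Int.not_even_iff_odd.2 hE
  have hu1n : ¬ Even u1 := Int.not_even_iff_odd.2 hu1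
  have n5 : ¬ Even (5 : ℤ) := by decide
  have e3 : Even b3 := by
    have := congrArg (fun z : ℤ => Even z) h6
    simpa [parity_simps, hu2e, Int.even_pow, n5] using this
  have e5 : ¬ Even k ∧ ¬ Even w2 := by
    have := congrArg (fun z : ℤ => Even z) h5
    simpa [parity_simps, hu2e, Int.even_pow, hEn, hu1n, n5] using this
  have e2 : Even b2 := by
    have := congrArg (fun z : ℤ => Even z) h4
    simpa [parity_simps, hu2e, hu0, Int.even_pow, hEn, hu1n, n5] using this
  have e1' : Even w1 := by
    have := congrArg (fun z : ℤ => Even z) h3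
    simpa [parity_simps, hu2e, hu0, Int.even_pow, hEn, hu1n, n5, e3, e5.1] using this
  have e1 : Even b1 := by
    have := congrArg (fun z : ℤ => Even z) h2
    simpa [parity_simps, hu2e, hu0, Int.even_pow, hEn, hu1n, n5, e2] using this
  have e0' : Even w0 := by
    have := congrArg (fun z : ℤ => Even z) h1
    simpa [parity_simps, hu2e, hu0, Int.even_pow, hEn, hu1n, n5, e1, e5.1] using this
  refine ⟨w2, w1, w0, ⟨Int.not_even_iff_odd.1 e5.2, e1', e0', E, b3, b2, b1, b0, _, _, _, _, _, hE,
    BData_swap hB⟩, fun m hm hm1 hm0 => ?_⟩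
  exact levelI hm hE (Int.not_even_iff_odd.1 e5.1) (Int.not_even_iff_odd.1 e5.2) hb0 hB hm1 hm0

end RC

namespace RC

theorem hensel_false {d v3 v2 v1 v0 u2 u1 u0 q4 q3 q2 q1 q0 : ℤ} (hd : d ≠ 0)
    (hu1 : Odd u1) (hu0 : Even u0) (hu2 : Even u2) (h4 : ¬ 4 ∣ u2)
    (h : EData d v3 v2 v1 v0 u2 u1 u0 q4 q3 q2 q1 q0) : False := by
  obtain ⟨c, rfl⟩ := even_iff_two_dvd.1 hu2
  have hc : Odd c := by
    rw [← Int.not_even_iff_odd]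
    rintro ⟨r, rfl⟩
    exact h4 ⟨r, by ring⟩
  clear h4
  obtain ⟨z, hz, hz1⟩ : ∃ z : ℤ_[2], (c : ℤ_[2]) * z ^ 2 + u1 * z + 2 * u0 = 0 ∧ ‖z - 1‖ < 1 := by
    let F : Polynomial ℤ_[2] := C (c : ℤ_[2]) * X ^ 2 + C (u1 : ℤ_[2]) * X + C (2 * u0 : ℤ_[2])
    have hF1 : F.aeval (1 : ℤ_[2]) = ((c + u1 + 2 * u0 : ℤ) : ℤ_[2]) := by
      simp [F]
    have hF2 : F.derivative.aeval (1 : ℤ_[2]) = ((2 * c + u1 : ℤ) : ℤ_[2]) := by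
      simp [F]; ring
    have hn1 : ‖F.aeval (1 : ℤ_[2])‖ < 1 := by
      rw [hF1, PadicInt.norm_int_lt_one_iff_dvd]
      exact even_iff_two_dvd.1 ((hc.add_odd hu1).add (even_two_mul _))
    have hn2 : ‖F.derivative.aeval (1 : ℤ_[2])‖ = 1 := by
      refine le_antisymm (PadicInt.norm_le_one _) ?_
      rw [← not_lt, hF2, PadicInt.norm_int_lt_one_iff_dvd]
      intro hdv
      exact Int.not_even_iff_odd.2 ((even_two_mul c).add_odd hu1) (even_iff_two_dvd.2 hdv)
    obtain ⟨z, hz, hz1, -⟩ := hensels_lemma (p := 2) (F := F) (a := 1) (by rw [hn2]; simpa using hn1)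
    refine ⟨z, ?_, by rwa [hn2] at hz1⟩
    simpa [F] using hz
  obtain ⟨h6, h5, h4, h3, h2, h1, h0⟩ := h
  have c6 := congrArg (Int.cast : ℤ → ℤ_[2]) h6
  have c5 := congrArg (Int.cast : ℤ → ℤ_[2]) h5
  have c4 := congrArg (Int.cast : ℤ → ℤ_[2]) h4
  have c3 := congrArg (Int.cast : ℤ → ℤ_[2]) h3
  have c2 := congrArg (Int.cast : ℤ → ℤ_[2]) h2
  have c1 := congrArg (Int.cast : ℤ → ℤ_[2]) h1
  have c0 := congrArg (Int.cast : ℤ → ℤ_[2]) h0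
  push_cast at c6 c5 c4 c3 c2 c1 c0
  set T : ℤ_[2] := v3 * z ^ 3 + 2 * v2 * z ^ 2 + 4 * v1 * z + 8 * v0 with hT
  have hmain : 8 * (d : ℤ_[2]) ^ 2 * ((2 + z) ^ 5 + 8) = 5 * T ^ 2 := by
    rw [hT]
    linear_combination c6 * z ^ 6 + 2 * c5 * z ^ 5 + 4 * c4 * z ^ 4 + 8 * c3 * z ^ 3 + 16 * c2 * z ^ 2
      + 32 * c1 * z + 64 * c0 + 2 * hz * (q4 * z ^ 4 + 2 * q3 * z ^ 3 + 4 * q2 * z ^ 2 + 8 * q1 * z + 16 * q0)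
  have hs : ‖(2 + z) ^ 5 + 8‖ = 1 := by
    rw [← PadicInt.isUnit_iff]
    by_contra hcon
    rw [PadicInt.not_isUnit_iff, PadicInt.norm_lt_one_iff_dvd] at hcon
    rw [PadicInt.norm_lt_one_iff_dvd] at hz1
    obtain ⟨y, hy⟩ := hz1
    obtain ⟨s, hs⟩ := hcon
    obtain rfl : z = 1 + 2 * y := by push_cast at hy; linear_combination hy
    have : ¬ IsUnit (((2 : ℕ) : ℤ_[2])) := by
      have := (PadicInt.prime_p (p := 2)).not_unit
      simpa using this
    apply this
    push_cast at hs ⊢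
    refine IsUnit.of_mul_eq_one (s - ((2 + (1 + 2 * y)) ^ 5 + 7 - (32 * y ^ 5 + 240 * y ^ 4 + 720 * y ^ 3 + 1080 * y ^ 2 + 810 * y + 243 + 7) + (16 * y ^ 5 + 120 * y ^ 4 + 360 * y ^ 3 + 540 * y ^ 2 + 405 * y + 125))) ?_
    linear_combination -hs
  have h5 : ‖(5 : ℤ_[2])‖ = 1 := by
    refine le_antisymm (PadicInt.norm_le_one _) ?_
    rw [← not_lt]
    have := (PadicInt.norm_int_lt_one_iff_dvd (p := 2) 5)
    push_cast at this
    rw [this]; decide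
  have hd0 : (d : ℤ_[2]) ≠ 0 := by exact_mod_cast hd
  have h8 : ‖(8 : ℤ_[2])‖ = (2 : ℝ)⁻¹ ^ 3 := by
    have : (8 : ℤ_[2]) = ((2 : ℕ) : ℤ_[2]) ^ 3 := by norm_num
    rw [this, norm_pow, PadicInt.norm_p]; norm_num
  have hn := congrArg norm hmain
  simp only [norm_mul, norm_pow, hs, h5, h8, mul_one, one_mul] at hn
  have hT0 : T ≠ 0 := by
    intro h0
    rw [h0] at hn
    have : (0:ℝ) < ‖(d : ℤ_[2])‖ := norm_pos_iff.2 hd0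
    have h' : (0 : ℝ) < 2⁻¹ ^ 3 * ‖(d : ℤ_[2])‖ ^ 2 := by positivity
    rw [hn] at h'
    simp at h'
  rw [PadicInt.norm_eq_zpow_neg_valuation hd0, PadicInt.norm_eq_zpow_neg_valuation hT0] at hn
  have : ((2 : ℕ) : ℝ) ^ (-3 - 2 * (d : ℤ_[2]).valuation : ℤ) = ((2 : ℕ) : ℝ) ^ (- 2 * T.valuation : ℤ) := by
    have e1 : (-3 - 2 * ((d : ℤ_[2]).valuation : ℤ)) = (-3) + (-((d : ℤ_[2]).valuation : ℤ)) * (2 : ℕ) := by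
      push_cast; ring
    have e2 : (-2 * (T.valuation : ℤ)) = (-(T.valuation : ℤ)) * (2 : ℕ) := by
      push_cast; ring
    rw [e1, e2, zpow_add₀ (by norm_num), zpow_mul, zpow_mul, zpow_natCast, zpow_natCast, ← hn]
    norm_num
  have h' := zpow_right_injective₀ (by norm_num) (by norm_num) this
  omega

end RC

namespace RC

theorem S1_linear {a c D N : ℤ} (ha : Odd a) (hc : Even c) (hD : D ≠ 0)
    (h : 5 * N ^ 2 = D ^ 2 * a * (4 * (a - c) ^ 5 + a ^ 5)) : S1 0 a c := by
  have ha0 : a ≠ 0 := by rintro rfl; exact absurd ha (by decide)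
  refine ⟨ha, hc, dvd_zero 4, a ^ 3 * D, 0, 0, 0, N, 4 * a ^ 5 * D ^ 2, a ^ 4 * D ^ 2 * (20 * a - 4 * c),
    a ^ 3 * D ^ 2 * (40 * a ^ 2 - 20 * a * c + 4 * c ^ 2),
    a ^ 2 * D ^ 2 * (40 * a ^ 3 - 40 * a ^ 2 * c + 20 * a * c ^ 2 - 4 * c ^ 3),
    a * D ^ 2 * (20 * a ^ 4 - 40 * a ^ 3 * c + 40 * a ^ 2 * c ^ 2 - 20 * a * c ^ 3 + 4 * c ^ 4),
    mul_ne_zero (pow_ne_zero _ ha0) hD, ?_, ?_, ?_, ?_, ?_, ?_, ?_⟩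
  · ring
  · ring
  · ring
  · ring
  · ring
  · ring
  · linear_combination -h

theorem disc_zero {u2 u1 u0 l1 l0 k w2 w1 w0 : ℤ} (hk : k ≠ 0) (hl : ¬ (l1 = 0 ∧ l0 = 0))
    (h4 : 5 * u2 * l1 ^ 2 = k * w2 ^ 2)
    (h3 : 5 * (u1 * l1 ^ 2 + 2 * u2 * l1 * l0) = 2 * k * w2 * w1)
    (h2 : 5 * (u0 * l1 ^ 2 + 2 * u1 * l1 * l0 + u2 * l0 ^ 2) = k * (w1 ^ 2 + 2 * w2 * w0))
    (h1 : 5 * (2 * u0 * l1 * l0 + u1 * l0 ^ 2) = 2 * k * w1 * w0)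
    (h0 : 5 * u0 * l0 ^ 2 = k * w0 ^ 2) : u1 ^ 2 = 4 * u2 * u0 := by
  by_cases hl1 : l1 = 0
  · subst hl1
    have hl0 : l0 ≠ 0 := fun h => hl ⟨rfl, h⟩
    have hw2 : w2 = 0 := by
      have : k * w2 ^ 2 = 0 := by linear_combination -h4
      simpa [hk] using this
    subst hw2
    apply mul_left_cancel₀ (show 25 * l0 ^ 4 ≠ 0 by positivity)
    linear_combination (5 * u1 * l0 ^ 2 + 2 * k * w1 * w0) * h1 - 20 * u0 * l0 ^ 2 * h2 - 4 * k * w1 ^ 2 * h0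
  · have hR : w2 * l0 ^ 2 - w1 * l1 * l0 + w0 * l1 ^ 2 = 0 := by
      have : k * (w2 * l0 ^ 2 - w1 * l1 * l0 + w0 * l1 ^ 2) ^ 2 = 0 := by
        linear_combination -l0 ^ 4 * h4 + l0 ^ 3 * l1 * h3 - l0 ^ 2 * l1 ^ 2 * h2 + l0 * l1 ^ 3 * h1 - l1 ^ 4 * h0
      simpa [hk] using this
    have g2 : 5 * u2 * l1 ^ 4 = k * (w2 * l1) ^ 2 := by linear_combination l1 ^ 2 * h4
    have g1 : 5 * u1 * l1 ^ 4 = 2 * k * (w2 * l1) * (w1 * l1 - w2 * l0) := by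
      linear_combination l1 ^ 2 * h3 - 2 * l0 * l1 * h4
    have g0 : 5 * u0 * l1 ^ 4 = k * (w1 * l1 - w2 * l0) ^ 2 := by
      linear_combination l1 ^ 2 * h2 - 2 * l0 * l1 * h3 + 3 * l0 ^ 2 * h4 + 2 * k * w2 * hR
    apply mul_left_cancel₀ (show 25 * l1 ^ 8 ≠ 0 by positivity)
    linear_combination (5 * u1 * l1 ^ 4 + 2 * k * (w2 * l1) * (w1 * l1 - w2 * l0)) * g1
      - 20 * u0 * l1 ^ 4 * g2 - 4 * k * (w2 * l1) ^ 2 * g0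

/-- the degenerate case `e = 0` of the second step -/
theorem stepII_zero {u2 u1 u0 : ℤ} (h : S2 u2 u1 u0) (hdisc : u1 ^ 2 = 4 * u2 * u0) :
    ∃ w2 w1 w0, S1 w2 w1 w0 ∧
    ∀ m : ℕ, 1 ≤ m → (4 ^ m : ℤ) ∣ w2 → (2 ^ m : ℤ) ∣ w0 → (2 ^ (m + 1) : ℤ) ∣ u1 ∧ (2 ^ (m + 1) : ℤ) ∣ u0 := by
  obtain ⟨hu2, hu1, hu0, d, b3, b2, b1, b0, q4, q3, q2, q1, q0, hd, hB⟩ := h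
  obtain ⟨c, rfl⟩ := even_iff_two_dvd.1 hu1
  have hc2 : c ^ 2 = u2 * u0 := by
    apply mul_left_cancel₀ (show (4 : ℤ) ≠ 0 by norm_num); linear_combination hdisc
  have hc : Even c := by
    have : Even (c ^ 2) := hc2 ▸ hu0.mul_left u2
    exact (Int.even_pow.1 this).1
  have hd0 : d ≠ 0 := by rintro rfl; exact absurd hd (by decide)
  refine ⟨0, u2, c, ?_, ?_⟩
  · obtain ⟨h6, h5, h4, h3, h2, h1, h0⟩ := EData_of_BData hB
    refine S1_linear (D := d) (N := -(2 * b3) * c ^ 3 + (2 * d + 2 * b2) * c ^ 2 * u2 - (2 * d + 2 * b1) * c * u2 ^ 2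
      + (d + 2 * b0) * u2 ^ 3) hu2 hc hd0 ?_
    linear_combination -(c ^ 6 * h6 - c ^ 5 * u2 * h5 + c ^ 4 * u2 ^ 2 * h4 - c ^ 3 * u2 ^ 3 * h3
      + c ^ 2 * u2 ^ 4 * h2 - c * u2 ^ 5 * h1 + u2 ^ 6 * h0)
      + u2 * hc2 * (c ^ 4 * (4 * q4) - c ^ 3 * u2 * (4 * q3) + c ^ 2 * u2 ^ 2 * (4 * q2) - c * u2 ^ 3 * (4 * q1)
        + u2 ^ 4 * (4 * q0))
  · rintro m hm - ⟨y, rfl⟩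
    constructor
    · exact ⟨y, by ring⟩
    · refine odd_pow_dvd hu2 ?_
      obtain ⟨n, rfl⟩ : ∃ n, m = n + 1 := ⟨m - 1, by omega⟩
      exact ⟨2 ^ n * y ^ 2, by linear_combination -hc2⟩

theorem exists_two_pow {e : ℤ} (he : e ≠ 0) : ∃ (s : ℕ) (e' : ℤ), Odd e' ∧ e = 2 ^ s * e' := by
  have hfin : FiniteMultiplicity 2 e := Int.finiteMultiplicity_iff.2 ⟨by decide, he⟩
  obtain ⟨c, hc, hc'⟩ := hfin.exists_eq_pow_mul_and_not_dvd
  exact ⟨_, c, Int.not_even_iff_odd.1 (fun h => hc' (even_iff_two_dvd.1 h)), hc⟩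

/-- `l1` is even -/
theorem l1_even {d b3 b2 b1 b0 u2 u1 u0 q4 q3 q2 q1 q0 l1 l0 e k w2 w1 w0 : ℤ} (hd : Odd d) (hk : Odd k)
    (he : e ≠ 0)
    (hW : WData (2 * b3) (2 * d + 2 * b2) (2 * d + 2 * b1) (d + 2 * b0) u2 u1 u0
      (4 * q4) (4 * q3) (4 * q2) (4 * q1) (4 * q0) l1 l0 e k w2 w1 w0) : Even l1 := by
  by_contra hl
  have hl1 : Odd l1 := Int.not_even_iff_odd.1 hl
  obtain ⟨h4, h3, h2, h1, h0⟩ := hW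
  obtain ⟨s, e, he', rfl⟩ := exists_two_pow he
  set P : ℤ := 2 ^ s with hP
  have hP1 : (2 : ℤ) ^ (s + 1) = 2 * P := by rw [hP]; ring
  obtain ⟨n, hn⟩ : (2 ^ (s + 1) : ℤ) ∣ w2 * l0 ^ 2 - w1 * l1 * l0 + w0 * l1 ^ 2 := by
    rw [← Int.pow_dvd_pow_iff (n := 2) (by norm_num)]
    rw [← pow_mul]
    refine odd_pow_dvd hk ?_
    rw [pow_mul, hP1]
    refine ⟨-e ^ 2 * (q4 * l0 ^ 4 - q3 * l0 ^ 3 * l1 + q2 * l0 ^ 2 * l1 ^ 2 - q1 * l0 * l1 ^ 3 + q0 * l1 ^ 4), ?_⟩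
    linear_combination -(l0 ^ 4 * h4 - l0 ^ 3 * l1 * h3 + l0 ^ 2 * l1 ^ 2 * h2 - l0 * l1 ^ 3 * h1 + l1 ^ 4 * h0)
  rw [hP1] at hn
  have hder : k * (w2 * l0 ^ 2 - w1 * l1 * l0 + w0 * l1 ^ 2) * (w1 * l1 - 2 * w2 * l0) =
    5 * (P * e) * l1 * (-(2 * b3) * l0 ^ 3 + (2 * d + 2 * b2) * l0 ^ 2 * l1 - (2 * d + 2 * b1) * l0 * l1 ^ 2
      + (d + 2 * b0) * l1 ^ 3) - 2 * (P * e) ^ 2 * (-4 * q4 * l0 ^ 3 + 3 * q3 * l0 ^ 2 * l1 - 2 * q2 * l0 * l1 ^ 2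
      + q1 * l1 ^ 3) := by
    apply mul_left_cancel₀ (show (2 : ℤ) ≠ 0 by norm_num)
    linear_combination -(-4 * l0 ^ 3 * h4 + 3 * l0 ^ 2 * l1 * h3 - 2 * l0 * l1 ^ 2 * h2 + l1 ^ 3 * h1)
  rw [hn] at hder
  have hPne : P ≠ 0 := by rw [hP]; positivity
  have hc : k * (2 * n) * (w1 * l1 - 2 * w2 * l0) =
    5 * e * l1 * (-(2 * b3) * l0 ^ 3 + (2 * d + 2 * b2) * l0 ^ 2 * l1 - (2 * d + 2 * b1) * l0 * l1 ^ 2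
      + (d + 2 * b0) * l1 ^ 3) - 2 * P * e ^ 2 * (-4 * q4 * l0 ^ 3 + 3 * q3 * l0 ^ 2 * l1 - 2 * q2 * l0 * l1 ^ 2
      + q1 * l1 ^ 3) := by
    apply mul_left_cancel₀ hPne
    linear_combination hder
  have := congrArg (fun z : ℤ => Even z) hc
  have n5 : ¬ Even (5 : ℤ) := by decide
  rw [← Int.not_even_iff_odd] at hd he'
  simp [parity_simps, Int.even_pow, hl, hd, he', n5] at this

theorem levelII {m : ℕ} (hm : 1 ≤ m) {d b3 b2 b1 b0 u2 u1 u0 q4 q3 q2 q1 q0 l1 l0 e k w2 w1 w0 : ℤ}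
    (hu2 : Odd u2) (hu1 : Even u1) (hq3 : Odd q3) (hl0 : Odd l0) (h6 : -5 * b3 ^ 2 = u2 * q4)
    (hW : WData (2 * b3) (2 * d + 2 * b2) (2 * d + 2 * b1) (d + 2 * b0) u2 u1 u0
      (4 * q4) (4 * q3) (4 * q2) (4 * q1) (4 * q0) l1 l0 e k w2 w1 w0)
    (hw2 : (4 ^ m : ℤ) ∣ w2) (hw0 : (2 ^ m : ℤ) ∣ w0) : (2 ^ (m + 1) : ℤ) ∣ u1 ∧ (2 ^ (m + 1) : ℤ) ∣ u0 := by
  obtain ⟨h4, h3, h2, h1, h0⟩ := hW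
  have h5o : Odd (5 : ℤ) := ⟨2, by norm_num⟩
  have h42 : (4 : ℤ) ^ m = 2 ^ (2 * m) := by rw [pow_mul]; norm_num
  rw [h42] at hw2
  obtain ⟨y, hy⟩ : (2 ^ (2 * m) : ℤ) ∣ u2 * l1 + 2 * e * b3 := by
    rw [← Int.pow_dvd_pow_iff (n := 2) (by norm_num), ← pow_mul]
    refine odd_pow_dvd h5o ?_
    rw [pow_mul]
    obtain ⟨z, rfl⟩ := hw2
    exact ⟨k * u2 * z ^ 2, by linear_combination u2 * h4 - 4 * e ^ 2 * h6⟩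
  have hl1 : ∀ s, s + 1 ≤ 2 * m → (2 ^ s : ℤ) ∣ e → (2 ^ (s + 1) : ℤ) ∣ l1 := by
    rintro s hs ⟨e', rfl⟩
    refine odd_pow_dvd hu2 ?_
    obtain ⟨z, hz⟩ := pow_dvd_pow (2 : ℤ) hs
    rw [hz] at hy
    exact ⟨z * y - e' * b3, by linear_combination hy⟩
  have he : ∀ s, s ≤ m → (2 ^ s : ℤ) ∣ e := by
    intro s
    induction s with
    | zero => intro _; simp
    | succ s ih =>
      intro hs
      have hse := ih (by omega)
      obtain ⟨n1, rfl⟩ := hl1 s (by omega) hse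
      obtain ⟨e', rfl⟩ := hse
      obtain ⟨z, hz⟩ := hw2
      obtain ⟨x, hx⟩ := pow_dvd_pow (2 : ℤ) (show 2 * s + 2 ≤ 2 * m by omega)
      have hx' : (2 : ℤ) ^ (2 * m) = 4 * (2 ^ s) ^ 2 * x := by rw [hx]; ring
      rw [hx'] at hy hz
      have hP1 : (2 : ℤ) ^ (s + 1) = 2 * 2 ^ s := by ring
      rw [hP1] at hy h3 ⊢
      set P : ℤ := 2 ^ s with hP
      have hPne : 4 * P ^ 2 ≠ 0 := by rw [hP]; positivity
      have hc : 5 * u1 * n1 ^ 2 + 10 * e' * (d + b2) * n1 + 10 * l0 * (x * y) - e' ^ 2 * q3 =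
          2 * k * (x * z) * w1 := by
        apply mul_left_cancel₀ hPne
        rw [hz] at h3
        linear_combination h3 - 10 * l0 * hy
      have := congrArg (fun z : ℤ => Even z) hc
      have n10 : Even (10 : ℤ) := by decide
      rw [← Int.not_even_iff_odd] at hq3
      simp [parity_simps, Int.even_pow, hu1, hq3, n10] at this
      obtain ⟨e'', rfl⟩ := even_iff_two_dvd.1 this
      exact ⟨e'', by ring⟩
  have hem := he m le_rfl
  obtain ⟨n1, rfl⟩ := hl1 m (by omega) hem
  obtain ⟨e', rfl⟩ := hem
  obtain ⟨z, rfl⟩ := hw0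
  obtain ⟨n, rfl⟩ : ∃ n, m = n + 1 := ⟨m - 1, by omega⟩
  have hM : (2 : ℤ) ^ (n + 1 + 1) = 4 * 2 ^ n := by ring
  have hM' : (2 : ℤ) ^ (n + 1) = 2 * 2 ^ n := by ring
  have hl : Odd (5 * l0 ^ 2) := h5o.mul hl0.pow
  rw [hM, hM'] at h1
  rw [hM'] at h0
  constructor
  · refine odd_pow_dvd hl ?_
    rw [hM]
    exact ⟨k * w1 * z - 5 * (2 * u0 * n1 * l0) - 5 * e' * ((d + 2 * b0) * (4 * 2 ^ n * n1) + 2 * (d + b1) * l0)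
      + 4 * 2 ^ n * e' ^ 2 * q1, by linear_combination h1⟩
  · refine odd_pow_dvd hl ?_
    rw [hM]
    exact ⟨k * 2 ^ n * z ^ 2 - 5 * e' * (d + 2 * b0) * l0 + 4 * 2 ^ n * e' ^ 2 * q0, by linear_combination h0⟩

theorem stepII {u2 u1 u0 : ℤ} (h : S2 u2 u1 u0) :
    ∃ w2 w1 w0, S1 w2 w1 w0 ∧
    ∀ m : ℕ, 1 ≤ m → (4 ^ m : ℤ) ∣ w2 → (2 ^ m : ℤ) ∣ w0 → (2 ^ (m + 1) : ℤ) ∣ u1 ∧ (2 ^ (m + 1) : ℤ) ∣ u0 := by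
  have hS := h
  obtain ⟨hu2, hu1, hu0, d, b3, b2, b1, b0, q4, q3, q2, q1, q0, hd, hB⟩ := h
  have hd0 : d ≠ 0 := by rintro rfl; exact absurd hd (by decide)
  have hE := EData_of_BData hB
  obtain ⟨l1, l0, e, k, w2, w1, w0, hk0, hl, hw, hW⟩ := H2 hd0 hE (Or.inr ⟨hu2, hu1, hu0⟩)
  have n5 : ¬ Even (5 : ℤ) := by decide
  have n10 : Even (10 : ℤ) := by decide
  have n4 : Even (4 : ℤ) := by decide
  have hu2n : ¬ Even u2 := Int.not_even_iff_odd.2 hu2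
  have hdn : ¬ Even d := Int.not_even_iff_odd.2 hd
  have hq3n : ¬ Even q3 := by
    have := congrArg (fun z : ℤ => Even z) hB.2.1
    simpa [parity_simps, Int.even_pow, hdn, hu2n, hu1] using this
  have hq3 := Int.not_even_iff_odd.1 hq3n
  have hk : Odd k := by
    by_contra hkn
    rw [Int.not_odd_iff_even] at hkn
    obtain ⟨h4, h3, h2, h1, h0⟩ := hW
    have e1 : Even l1 := by
      have := congrArg (fun z : ℤ => Even z) h4
      simpa [parity_simps, Int.even_pow, hkn, hu2n, hu1, n5, n10, n4] using this
    have e0 : Even l0 := by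
      have := congrArg (fun z : ℤ => Even z) h2
      simpa [parity_simps, Int.even_pow, hkn, hu2n, hu1, n5, n10, n4, hu0] using this
    obtain ⟨m1, rfl⟩ := even_iff_two_dvd.1 e1
    obtain ⟨m0, rfl⟩ := even_iff_two_dvd.1 e0
    obtain ⟨k', rfl⟩ : (2 ^ 2 : ℤ) ∣ k := by
      refine four_pow_dvd_of hw ?_ ?_ ?_
      · exact ⟨5 * u2 * m1 ^ 2 + 10 * e * b3 * m1 - e ^ 2 * q4, by linear_combination -h4⟩
      · exact ⟨5 * (u0 * m1 ^ 2 + 2 * u1 * m1 * m0 + u2 * m0 ^ 2) + 10 * e * ((d + b1) * m1 + (d + b2) * m0) - e ^ 2 * q2,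
          by linear_combination -h2⟩
      · exact ⟨5 * u0 * m0 ^ 2 + 5 * e * (d + 2 * b0) * m0 - e ^ 2 * q0, by linear_combination -h0⟩
    have hc : 5 * (u1 * m1 ^ 2 + 2 * u2 * m1 * m0) + 10 * e * ((d + b2) * m1 + b3 * m0) - e ^ 2 * q3 = 2 * k' * w2 * w1 := by
      apply mul_left_cancel₀ (show (4 : ℤ) ≠ 0 by norm_num)
      linear_combination h3
    have := congrArg (fun z : ℤ => Even z) hc
    simp [parity_simps, Int.even_pow, hq3n, n10, hu1] at this
    exact hl ⟨e1, e0, this⟩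
  have hkn := Int.not_even_iff_odd.2 hk
  by_cases he : e = 0
  · subst he
    refine stepII_zero hS ?_
    obtain ⟨h4, h3, h2, h1, h0⟩ := hW
    refine disc_zero (l1 := l1) (l0 := l0) (w2 := w2) (w1 := w1) (w0 := w0) hk0 ?_ ?_ ?_ ?_ ?_ ?_
    · rintro ⟨rfl, rfl⟩
      exact hl ⟨Even.zero, Even.zero, Even.zero⟩
    · linear_combination h4
    · linear_combination h3
    · linear_combination h2
    · linear_combination h1
    · linear_combination h0
  · have hl1 := l1_even hd hk he hW
    have hW' := hW
    obtain ⟨h4, h3, h2, h1, h0⟩ := hW'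
    have hw2 : Even w2 := by
      have := congrArg (fun z : ℤ => Even z) h4
      simpa [parity_simps, Int.even_pow, hkn, n10, n4, hl1] using this
    have hw0 : Even w0 := by
      have := congrArg (fun z : ℤ => Even z) h0
      simpa [parity_simps, Int.even_pow, hkn, n10, n4, hu0] using this
    have hw1 : ¬ Even w1 := fun h => hw ⟨hw2, h, hw0⟩
    have hl0 : ¬ Even l0 := by
      have := congrArg (fun z : ℤ => Even z) h2
      simpa [parity_simps, Int.even_pow, hkn, n10, n4, hu0, hu2n, hl1, hw1, n5, hu1] using this
    have hEW := EData_swap (EData_comp hE hW)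
    have hed : e * d ≠ 0 := mul_ne_zero he hd0
    have h4w : 4 ∣ w2 := by
      by_contra h4w
      exact hensel_false hed (Int.not_even_iff_odd.1 hw1) hw0 hw2 h4w hEW
    refine ⟨w2, w1, w0, ⟨Int.not_even_iff_odd.1 hw1, hw0, h4w, _, _, _, _, _, _, _, _, _, _, hed, hEW⟩, ?_⟩
    intro m hm hm2 hm0
    exact levelII hm hu2 hu1 hq3 (Int.not_even_iff_odd.1 hl0) hB.1 hW hm2 hm0

theorem S1_level (m : ℕ) : ∀ u2 u1 u0 : ℤ, S1 u2 u1 u0 → (4 ^ (m + 1) : ℤ) ∣ u2 ∧ (2 ^ (m + 1) : ℤ) ∣ u0 := by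
  induction m with
  | zero =>
    intro u2 u1 u0 h
    exact ⟨by simpa using h.2.2.1, by simpa using even_iff_two_dvd.1 h.2.1⟩
  | succ m ih =>
    intro u2 u1 u0 h
    obtain ⟨w2, w1, w0, hS2, hlev⟩ := stepI h
    obtain ⟨z2, z1, z0, hS1, hlev'⟩ := stepII hS2
    obtain ⟨i2, i0⟩ := ih _ _ _ hS1
    obtain ⟨j1, j0⟩ := hlev' (m + 1) (by omega) i2 i0
    obtain ⟨k0, k2⟩ := hlev (m + 1 + 1) (by omega) j1 j0
    exact ⟨dvd_trans (pow_dvd_pow _ (by omega)) k2, dvd_trans (pow_dvd_pow _ (by omega)) k0⟩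

theorem S1_zero {u2 u1 u0 : ℤ} (h : S1 u2 u1 u0) : u2 = 0 ∧ u0 = 0 := by
  have key : ∀ x : ℤ, (∀ m : ℕ, (2 ^ (m + 1) : ℤ) ∣ x) → x = 0 := by
    intro x hx
    by_contra h0
    have := Int.natAbs_dvd_natAbs.2 (hx x.natAbs)
    have h3 := Nat.le_of_dvd (Int.natAbs_pos.2 h0) this
    rw [Int.natAbs_pow] at h3
    have h4 : x.natAbs + 1 < 2 ^ (x.natAbs + 1) := Nat.lt_two_pow_self
    simp at h3; omega
  refine ⟨key _ fun m => dvd_trans ?_ (S1_level m _ _ _ h).1, key _ fun m => (S1_level m _ _ _ h).2⟩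
  exact pow_dvd_pow_of_dvd (by norm_num) _

end RC

namespace RC

theorem curve_int {A B p q : ℤ} (hAB : IsCoprime A B) (hpq : IsCoprime p q) (hB : B ≠ 0) (hq : q ≠ 0)
    (h : 5 * p ^ 2 * B ^ 5 = q ^ 2 * (4 * A ^ 5 + B ^ 5)) : A = B := by
  have n5 : ¬ Even (5 : ℤ) := by decide
  have n4 : Even (4 : ℤ) := by decide
  have hpq' : ¬ (Even p ∧ Even q) := by
    rintro ⟨h1, h2⟩
    have := hpq.isUnit_of_dvd' (even_iff_two_dvd.1 h1) (even_iff_two_dvd.1 h2)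
    exact absurd (Int.isUnit_iff.1 this) (by decide)
  have hAB' : ¬ (Even A ∧ Even B) := by
    rintro ⟨h1, h2⟩
    have := hAB.isUnit_of_dvd' (even_iff_two_dvd.1 h1) (even_iff_two_dvd.1 h2)
    exact absurd (Int.isUnit_iff.1 this) (by decide)
  rcases Int.even_or_odd B with hBe | hBo
  · exfalso
    have hA : ¬ Even A := fun h => hAB' ⟨h, hBe⟩
    have h4 : 4 ∣ B := by
      obtain ⟨B', rfl⟩ := even_iff_two_dvd.1 hBe
      rcases Int.even_or_odd B' with hb | hb
      · obtain ⟨b, rfl⟩ := even_iff_two_dvd.1 hb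
        exact ⟨b, by ring⟩
      exfalso
      have hbn := Int.not_even_iff_odd.2 hb
      have e1 : 8 * (5 * B' ^ 5) * p ^ 2 = (A ^ 5 + 8 * B' ^ 5) * q ^ 2 := by
        apply mul_left_cancel₀ (show (4 : ℤ) ≠ 0 by norm_num); linear_combination h
      have n8 : Even (8 : ℤ) := by decide
      have q1 : Even q := by
        have := congrArg (fun z : ℤ => Even z) e1
        simpa [parity_simps, Int.even_pow, hA, n8] using this
      obtain ⟨q', rfl⟩ := even_iff_two_dvd.1 q1
      have e2 : 2 * (5 * B' ^ 5) * p ^ 2 = (A ^ 5 + 8 * B' ^ 5) * q' ^ 2 := by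
        apply mul_left_cancel₀ (show (4 : ℤ) ≠ 0 by norm_num); linear_combination e1
      have q2 : Even q' := by
        have := congrArg (fun z : ℤ => Even z) e2
        simpa [parity_simps, Int.even_pow, hA, n8] using this
      obtain ⟨q'', rfl⟩ := even_iff_two_dvd.1 q2
      have e3 : (5 * B' ^ 5) * p ^ 2 = 2 * (A ^ 5 + 8 * B' ^ 5) * q'' ^ 2 := by
        apply mul_left_cancel₀ (show (2 : ℤ) ≠ 0 by norm_num); linear_combination e2
      have p1 : Even p := by
        have := congrArg (fun z : ℤ => Even z) e3
        simpa [parity_simps, Int.even_pow, hA, n8, hbn, n5] using this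
      exact hpq' ⟨p1, q1⟩
    have hA1 : Odd A := Int.not_even_iff_odd.1 hA
    have ha : Odd (A - B) := hA1.sub_even hBe
    have ha0 : A - B ≠ 0 := by intro h0; rw [h0] at ha; exact absurd ha (by decide)
    have hS : S1 B (-(A - B)) 0 := by
      refine ⟨ha.neg, Even.zero, h4, q * (A - B) * B ^ 2, 0, 0, (p - q) * B * B ^ 2, q * (A - B) * B ^ 2,
        0, 4 * q ^ 2 * (A - B) ^ 2 * B ^ 3, q ^ 2 * (A - B) ^ 2 * (20 * B ^ 3 + 4 * (A - B) * B ^ 2),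
        q ^ 2 * (A - B) ^ 2 * (40 * B ^ 3 + 20 * (A - B) * B ^ 2 + 4 * (A - B) ^ 2 * B),
        q ^ 2 * (A - B) ^ 2 * (40 * B ^ 3 + 40 * (A - B) * B ^ 2 + 20 * (A - B) ^ 2 * B + 4 * (A - B) ^ 3)
          - 5 * (p - q) ^ 2 * B ^ 5,
        mul_ne_zero (mul_ne_zero hq ha0) (pow_ne_zero _ hB), ?_, ?_, ?_, ?_, ?_, ?_, ?_⟩
      · ring
      · ring
      · ring
      · ring
      · ring
      · linear_combination -(A - B) * h
      · ring
    exact hB (S1_zero hS).1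
  · have hBn := Int.not_even_iff_odd.2 hBo
    have hodd : Odd (4 * A ^ 5 + B ^ 5) := (n4.mul_right _).add_odd hBo.pow
    have hpe : Even p ↔ Even q := by
      have := congrArg (fun z : ℤ => Even z) h
      simpa [parity_simps, Int.even_pow, n4, n5, hBn] using this
    have hp : Odd p := by
      rw [← Int.not_even_iff_odd]; exact fun h => hpq' ⟨h, hpe.1 h⟩
    have hqo : Odd q := by
      rw [← Int.not_even_iff_odd]; exact fun h => hpq' ⟨hpe.2 h, h⟩
    have hA : Odd A := by
      by_contra hA
      rw [Int.not_odd_iff_even] at hA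
      obtain ⟨a, rfl⟩ := even_iff_two_dvd.1 hA
      obtain ⟨x, hx⟩ := Int.eight_dvd_sq_sub_one_of_odd hp
      obtain ⟨y, hy⟩ := Int.eight_dvd_sq_sub_one_of_odd hqo
      have hp2 : p ^ 2 = 8 * x + 1 := by linarith
      have hq2 : q ^ 2 = 8 * y + 1 := by linarith
      rw [hp2, hq2] at h
      have : B ^ 5 = 2 * ((8 * y + 1) * 16 * a ^ 5 + y * B ^ 5 - 5 * x * B ^ 5) := by
        apply mul_left_cancel₀ (show (4 : ℤ) ≠ 0 by norm_num); linear_combination h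
      have h2 : Even (B ^ 5) := by rw [this]; exact even_two_mul _
      exact hBn (Int.even_pow.1 h2).1
    have hS : S1 0 B (B - A) := by
      refine S1_linear (D := q) (N := B ^ 3 * p) hBo (hBo.sub_odd hA) hq ?_
      linear_combination B * h
    linarith [(S1_zero hS).2]

theorem curve (r V : ℚ) (h : 5 * V ^ 2 = 4 * r ^ 5 + 1) : r = 1 := by
  have hB : (r.den : ℚ) ≠ 0 := by exact_mod_cast r.den_ne_zero
  have hq : (V.den : ℚ) ≠ 0 := by exact_mod_cast V.den_ne_zero
  have e := curve_int (A := r.num) (B := r.den) (p := V.num) (q := V.den)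
    (Int.isCoprime_iff_gcd_eq_one.2 r.reduced) (Int.isCoprime_iff_gcd_eq_one.2 V.reduced)
    (by exact_mod_cast r.den_ne_zero) (by exact_mod_cast V.den_ne_zero) (by
      have h1 : r = r.num / r.den := (Rat.num_div_den r).symm
      have h2 : V = V.num / V.den := (Rat.num_div_den V).symm
      rw [h1, h2] at h
      field_simp at h
      have h' : (5 * (V.num : ℚ) ^ 2 * (r.den : ℚ) ^ 5) = (V.den : ℚ) ^ 2 * (4 * r.num ^ 5 + (r.den : ℚ) ^ 5) := by
        linear_combination h
      exact_mod_cast h')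
  rw [← Rat.num_div_den r, e]
  push_cast
  exact div_self hB

end RC

namespace RC

theorem D_ne (t : ℚ) : t ^ 2 + t - 1 ≠ 0 := by
  intro h
  have h5 : (2 * t + 1) ^ 2 = 5 := by linear_combination 4 * h
  have : IsSquare (5 : ℚ) := ⟨2 * t + 1, by rw [← h5]; ring⟩
  rw [Rat.isSquare_iff] at this
  obtain ⟨⟨r, hr⟩, -⟩ := this
  have hr' : r * r = 5 := by simpa using hr.symm
  have h1 : r < 3 := by nlinarith
  have h2 : -3 < r := by nlinarith
  interval_cases r <;> omega

theorem q4_ne (t : ℚ) : t ^ 4 - 3 * t ^ 3 - t ^ 2 + 3 * t + 1 ≠ 0 := by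
  intro h
  have hB : (t.den : ℚ) ≠ 0 := by exact_mod_cast t.den_ne_zero
  have h1 : t = t.num / t.den := (Rat.num_div_den t).symm
  rw [h1] at h
  field_simp at h
  have h' : t.num ^ 4 - 3 * t.num ^ 3 * t.den - t.num ^ 2 * t.den ^ 2 + 3 * t.num * t.den ^ 3 + t.den ^ 4 = 0 := by
    have : (t.num : ℚ) ^ 4 - 3 * t.num ^ 3 * t.den - t.num ^ 2 * t.den ^ 2 + 3 * t.num * t.den ^ 3 + t.den ^ 4 = 0 := by
      linear_combination h
    exact_mod_cast this
  have hc : IsCoprime t.num (t.den : ℤ) := Int.isCoprime_iff_gcd_eq_one.2 t.reduced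
  have hp : ¬ (Even t.num ∧ Even (t.den : ℤ)) := by
    rintro ⟨h1, h2⟩
    have := hc.isUnit_of_dvd' (even_iff_two_dvd.1 h1) (even_iff_two_dvd.1 h2)
    exact absurd (Int.isUnit_iff.1 this) (by decide)
  generalize t.num = a at *
  generalize (t.den : ℤ) = b at *
  have := congrArg (fun z : ℤ => Even z) h'
  have n3 : ¬ Even (3 : ℤ) := by decide
  simp [parity_simps, Int.even_pow, n3] at this
  tauto

theorem no_root (t y : ℚ) (h2 : t ≠ 2) (h1 : t ≠ 1)
    (hG : (t ^ 5 - 5 * t ^ 3 + 5 * t - 2) * y ^ 3 + (3 * t ^ 5 - 5 * t ^ 4 - 5 * t ^ 3 + 10 * t ^ 2 - 10 * t + 4) * y ^ 2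
      + (-2 * t ^ 5 - 5 * t ^ 4 + 25 * t ^ 3 - 20 * t ^ 2 - 1) * y + (-9 * t ^ 5 + 20 * t ^ 4 - 10 * t ^ 3 - 2) = 0) :
    False := by
  obtain ⟨N, hN⟩ : ∃ N, N = 3 * t ^ 3 - t ^ 2 - 2 * t - 1 + t * (t ^ 2 + t - 1) * y := ⟨_, rfl⟩
  obtain ⟨M, hM⟩ : ∃ M, M = (t ^ 2 + t - 1) * (t - 1 + y) := ⟨_, rfl⟩
  have hK : (2 * M ^ 3 + 2 * N * M ^ 2 - N ^ 2 * M + N ^ 3) + t * (3 * M ^ 3 - 7 * N * M ^ 2 + N ^ 2 * M - N ^ 3)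
      + t ^ 2 * (3 * M ^ 3 - 7 * N * M ^ 2 + 6 * N ^ 2 * M - N ^ 3) = 0 := by
    rw [hN, hM]
    linear_combination -(t ^ 2 + t - 1) * (t ^ 4 - 3 * t ^ 3 - t ^ 2 + 3 * t + 1) * hG
  have hNM : N - t * M = -(t ^ 4 - 3 * t ^ 3 - t ^ 2 + 3 * t + 1) := by rw [hN, hM]; ring
  have hM0 : M ≠ 0 := by
    intro h0
    rw [h0] at hK hNM
    have : (t ^ 2 + t - 1) * N ^ 3 = 0 := by linear_combination -hK
    have hN0 : N = 0 := by simpa [D_ne t] using this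
    rw [hN0] at hNM
    exact q4_ne t (by linear_combination hNM)
  obtain ⟨X, hX⟩ : ∃ X, X = N / M := ⟨_, rfl⟩
  have hNX : N = X * M := by rw [hX]; field_simp
  rw [hNX] at hK
  have hH : (2 + 2 * X - X ^ 2 + X ^ 3) + t * (3 - 7 * X + X ^ 2 - X ^ 3) + t ^ 2 * (3 - 7 * X + 6 * X ^ 2 - X ^ 3) = 0 := by
    apply mul_left_cancel₀ (pow_ne_zero 3 hM0)
    linear_combination hK
  by_cases hz : X = 1
  · subst hz
    have : (t - 2) ^ 2 = 0 := by linear_combination hH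
    have := pow_eq_zero_iff (two_ne_zero) |>.1 this
    exact h2 (by linarith)
  have hz' : X - 1 ≠ 0 := sub_ne_zero.2 hz
  have hdisc : (2 * (3 - 7 * X + 6 * X ^ 2 - X ^ 3) * t + (3 - 7 * X + X ^ 2 - X ^ 3)) ^ 2 =
      5 * ((X - 1) ^ 6 + 4 * (X - 1)) := by
    linear_combination 4 * (3 - 7 * X + 6 * X ^ 2 - X ^ 3) * hH
  have hr := curve (1 / (X - 1)) ((2 * (3 - 7 * X + 6 * X ^ 2 - X ^ 3) * t + (3 - 7 * X + X ^ 2 - X ^ 3)) / (5 * (X - 1) ^ 3)) (by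
    rw [div_pow, hdisc]
    field_simp
    ring)
  have hX2 : X = 2 := by
    field_simp at hr
    linarith
  subst hX2
  have : (t - 1) * (t - 2) = 0 := by linear_combination hH / 5
  rcases mul_eq_zero.1 this with h | h
  · exact h1 (by linarith)
  · exact h2 (by linarith)

end RC

/-- If `t ≠ 2` is rational and `α ∈ ℂ` is a root of `f t`, then `α ≠ 0` (since
`f t (0) = 1`) and `α + 1/α` is a root of `g t`. Moreover, if additionally `t ≠ 1`,
then `g t` is irreducible over `ℚ`. -/
theorem resolvent_cubic (t : ℚ) (h2 : t ≠ 2) (α : ℂ)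
    (hα : Polynomial.aeval α (f t) = 0) :
    α ≠ 0 ∧ Polynomial.aeval (α + 1/α) (g t) = 0 ∧ (t ≠ 1 → Irreducible (g t)) := by
  have hα' : α ^ 6 + (u t : ℂ) * α ^ 5 + (v t : ℂ) * α ^ 4 + (w t : ℂ) * α ^ 3 + (v t : ℂ) * α ^ 2
      + (u t : ℂ) * α + 1 = 0 := by
    simpa [f] using hα
  have h0 : α ≠ 0 := by
    rintro rfl
    simp at hα'
  refine ⟨h0, ?_, fun h1 => ?_⟩
  · have : Polynomial.aeval (α + 1/α) (g t) = (α + 1/α) ^ 3 + (u t : ℂ) * (α + 1/α) ^ 2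
        + ((v t : ℂ) - 3) * (α + 1/α) + ((w t : ℂ) - 2 * (u t : ℂ)) := by
      simp [g]
    rw [this]
    field_simp
    linear_combination hα'
  · have hdeg : (g t).natDegree = 3 := by
      unfold g; compute_degree!
    have hmon : (g t).Monic := by
      unfold g; monicity!
    rw [hmon.irreducible_iff_roots_eq_zero_of_degree_le_three (by omega) (by omega)]
    refine Multiset.eq_zero_of_forall_notMem fun y hy => ?_
    have hr : (g t).eval y = 0 := (Polynomial.mem_roots'.1 hy).2
    have hD := RC.D_ne t
    have ht2 : t - 2 ≠ 0 := sub_ne_zero.2 h2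
    have hr' : y ^ 3 + u t * y ^ 2 + (v t - 3) * y + (w t - 2 * u t) = 0 := by
      simpa [g] using hr
    refine RC.no_root t y h2 h1 ?_
    have e1 : u t * (t ^ 2 + t - 1) = 3*t^2 - 2*t + 2 := by
      exact div_mul_cancel₀ _ hD
    have e2 : v t * ((t - 2) * (t ^ 2 + t - 1) ^ 2) = t^5 - 5*t^4 + 10*t^3 - 20*t^2 + 15*t - 7 := by
      exact div_mul_cancel₀ _ (mul_ne_zero ht2 (pow_ne_zero 2 hD))
    have e3 : w t * ((t - 2) * (t ^ 2 + t - 1) ^ 2) = -3*t^5 + 10*t^4 - 20*t^3 + 20*t^2 - 20*t + 6 := by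
      exact div_mul_cancel₀ _ (mul_ne_zero ht2 (pow_ne_zero 2 hD))
    linear_combination (t - 2) * (t ^ 2 + t - 1) ^ 2 * hr' - (t - 2) * (t ^ 2 + t - 1) * (y ^ 2 - 2) * e1 - y * e2 - e3
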